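/- arXiv:1901.01367 — 9 statements merged into one kernel-verified Lean document; each statement's English description precedes it below -/
import Mathlib

section
/- Let p, q ∈ ℤ² with q ∧ p ≠ 0, let α ≥ 0, and assume q is of type I₀ relative to p, i.e. ‖q‖ < ‖p‖ and ‖q + n·p‖ > ‖p‖ for every integer n ≠ 0. Then there exist a real number λ > 0 and a square-summable sequence w : ℤ → ℝ, not identically zero, such that ρ_{n−1} w_{n−1} − ρ_{n+1} w_{n+1} = λ w_n for all n ∈ ℤ. (In other words, the linearized α-Euler operator L_{B,q} has a positive eigenvalue, so the unidirectional flow is linearly unstable.) -/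
open Filter Topology

/-- Euclidean norm of a point of the integer lattice `ℤ²`. -/
noncomputable def znorm (v : ℤ × ℤ) : ℝ := Real.sqrt ((v.1 : ℝ) ^ 2 + (v.2 : ℝ) ^ 2)

/-- The wedge product `q ∧ p = q₁p₂ − q₂p₁`. -/
def wedge (q p : ℤ × ℤ) : ℤ := q.1 * p.2 - q.2 * p.1

/-- The coefficients `ρ_n` of the linearized α-Euler operator `L_{B,q}`. -/
noncomputable def rho (p q : ℤ × ℤ) (α : ℝ) (n : ℤ) : ℝ :=
  1 - (znorm p ^ 2 * (1 + α ^ 2 * znorm p ^ 2)) /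
      (znorm (q + n • p) ^ 2 * (1 + α ^ 2 * znorm (q + n • p) ^ 2))

/-- The finite continued fraction `1 / (l c_n + 1 / (l c_{n+1} + ⋯))` with `N` levels, ending
in the tail value `1`. -/
noncomputable def truncFrac (c : ℕ → ℝ) (l : ℝ) : ℕ → ℕ → ℝ
  | 0, _ => 1
  | N + 1, n => 1 / (l * c n + truncFrac c l N (n + 1))

lemma truncFrac_mem_Icc {c : ℕ → ℝ} {C l : ℝ} (hc : ∀ n, c n ∈ Set.Icc 1 C) (hl : 0 ≤ l)
    (N n : ℕ) : truncFrac c l N n ∈ Set.Icc (1 / (C * (1 + l))) C := by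
  have hC : 1 ≤ C := (hc 0).1.trans (hc 0).2
  have hC0 : 0 < C := by linarith
  induction N generalizing n with
  | zero =>
    refine ⟨?_, hC⟩
    rw [truncFrac, div_le_one (by positivity)]
    nlinarith
  | succ N ih =>
    obtain ⟨h1, h2⟩ := ih (n + 1)
    obtain ⟨h3, h4⟩ := hc n
    have hs : 0 < 1 / (C * (1 + l)) := by positivity
    have hpos : 0 < l * c n + truncFrac c l N (n + 1) := by nlinarith
    refine ⟨?_, ?_⟩
    · rw [truncFrac]
      exact one_div_le_one_div_of_le hpos (by nlinarith)
    · rw [truncFrac, div_le_iff₀ hpos]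
      have h5 : 1 ≤ C * (l + 1 / (C * (1 + l))) := by
        have h6 : C * (l + 1 / (C * (1 + l))) - 1 = l * (C * (1 + l) - 1) / (1 + l) := by
          field_simp
          ring
        have h7 : 0 ≤ l * (C * (1 + l) - 1) / (1 + l) :=
          div_nonneg (mul_nonneg hl (by nlinarith)) (by linarith)
        linarith
      refine h5.trans (mul_le_mul_of_nonneg_left ?_ hC0.le)
      nlinarith

lemma truncFrac_pos {c : ℕ → ℝ} {C l : ℝ} (hc : ∀ n, c n ∈ Set.Icc 1 C) (hl : 0 ≤ l)
    (N n : ℕ) : 0 < truncFrac c l N n := by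
  have hC : 0 < C := by linarith [(hc 0).1, (hc 0).2]
  exact lt_of_lt_of_le (by positivity) (truncFrac_mem_Icc hc hl N n).1

lemma continuousOn_truncFrac {c : ℕ → ℝ} {C : ℝ} (hc : ∀ n, c n ∈ Set.Icc 1 C) (N n : ℕ) :
    ContinuousOn (fun l => truncFrac c l N n) (Set.Ici 0) := by
  induction N generalizing n with
  | zero => exact continuousOn_const
  | succ N ih =>
    refine continuousOn_const.div
      ((continuousOn_id.mul continuousOn_const).add (ih (n + 1))) fun l hl => ne_of_gt ?_
    have h1 := truncFrac_pos hc hl N (n + 1)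
    have h2 : 0 ≤ l * c n := mul_nonneg hl (by linarith [(hc n).1])
    exact add_pos_of_nonneg_of_pos h2 h1

lemma truncFrac_mul {c : ℕ → ℝ} {C l : ℝ} (hc : ∀ n, c n ∈ Set.Icc 1 C) (hl : 0 ≤ l)
    {N n : ℕ} (hn : n < N) :
    truncFrac c l (N - n) n * (l * c n + truncFrac c l (N - (n + 1)) (n + 1)) = 1 := by
  have h0 : N - n = (N - (n + 1)) + 1 := by omega
  have h1 := truncFrac_pos hc hl (N - (n + 1)) (n + 1)
  have h2 : 0 ≤ l * c n := mul_nonneg hl (by linarith [(hc n).1])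
  rw [h0, truncFrac]
  exact one_div_mul_cancel (by positivity)

lemma exists_truncFrac_add_eq {c d : ℕ → ℝ} {C e : ℝ} (hc : ∀ n, c n ∈ Set.Icc 1 C)
    (hd : ∀ n, d n ∈ Set.Icc 1 C) (he : 0 < e) (N : ℕ) :
    ∃ l ∈ Set.Icc 0 (2 * C / e), truncFrac c l N 0 + truncFrac d l N 0 = l * e := by
  have hC : 0 < C := by linarith [(hc 0).1, (hc 0).2]
  have hb : 0 ≤ 2 * C / e := by positivity
  have hcont : ContinuousOn (fun l => l * e - (truncFrac c l N 0 + truncFrac d l N 0))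
      (Set.Icc 0 (2 * C / e)) :=
    ((continuousOn_id.mul continuousOn_const).sub
      ((continuousOn_truncFrac hc N 0).add (continuousOn_truncFrac hd N 0))).mono
        fun x hx => hx.1
  obtain ⟨l, hl, hl0⟩ := intermediate_value_Icc hb hcont (show (0 : ℝ) ∈ _ by
    constructor
    · have h1 := truncFrac_pos hc le_rfl N 0
      have h2 := truncFrac_pos hd le_rfl N 0
      linarith
    · have h1 := (truncFrac_mem_Icc hc hb N 0).2
      have h2 := (truncFrac_mem_Icc hd hb N 0).2
      have h3 : 2 * C / e * e = 2 * C := div_mul_cancel₀ _ he.ne'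
      linarith)
  exact ⟨l, hl, by simp only at hl0; linarith⟩

/-- Two infinite continued fractions with coefficients in `[1, C]`, matched at their first terms. -/
lemma exists_matched_continued_fractions {c d : ℕ → ℝ} {C e : ℝ}
    (hc : ∀ n, c n ∈ Set.Icc 1 C) (hd : ∀ n, d n ∈ Set.Icc 1 C) (he : 0 < e) :
    ∃ l : ℝ, 0 < l ∧ ∃ u v : ℕ → ℝ, (∀ n, 0 < u n) ∧ (∀ n, 0 < v n) ∧
      (∀ n, u n * (l * c n + u (n + 1)) = 1) ∧ (∀ n, v n * (l * d n + v (n + 1)) = 1) ∧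
      u 0 + v 0 = l * e := by
  have hC : 0 < C := by linarith [(hc 0).1, (hc 0).2]
  set b := 2 * C / e with hb
  have hb0 : 0 ≤ b := by positivity
  set s := 1 / (C * (1 + b)) with hs
  have hs0 : 0 < s := by positivity
  let box : Set (ℕ → ℝ) := Set.univ.pi fun _ => Set.Icc s C
  have hbox : IsCompact box := isCompact_univ_pi fun _ => isCompact_Icc
  let K : Set (ℝ × (ℕ → ℝ) × (ℕ → ℝ)) := Set.Icc 0 b ×ˢ box ×ˢ box
  have hK : IsCompact K := isCompact_Icc.prod (hbox.prod hbox)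
  let E : ℕ → Set (ℝ × (ℕ → ℝ) × (ℕ → ℝ)) := fun N =>
    {x | (∀ n < N, x.2.1 n * (x.1 * c n + x.2.1 (n + 1)) = 1) ∧
      (∀ n < N, x.2.2 n * (x.1 * d n + x.2.2 (n + 1)) = 1) ∧ x.2.1 0 + x.2.2 0 = x.1 * e}
  have hE : ∀ N, IsClosed (E N) := fun N => by
    simp only [E, Set.ofPred_and, Set.ofPred_forall]
    refine .inter (isClosed_iInter fun n => isClosed_iInter fun _ => ?_)
      (.inter (isClosed_iInter fun n => isClosed_iInter fun _ => ?_) ?_)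
    all_goals exact isClosed_eq (by fun_prop) (by fun_prop)
  obtain ⟨⟨l, u, v⟩, hx⟩ := IsCompact.nonempty_iInter_of_sequence_nonempty_isCompact_isClosed
    (fun N => K ∩ E N)
    (fun N x hx => ⟨hx.1, fun n hn => hx.2.1 n (by omega), fun n hn => hx.2.2.1 n (by omega),
      hx.2.2.2⟩)
    (fun N => by
      obtain ⟨l, hl, hl0⟩ := exists_truncFrac_add_eq hc hd he N
      have hsl : s ≤ 1 / (C * (1 + l)) := by
        have := hl.1
        exact one_div_le_one_div_of_le (by positivity)
          (mul_le_mul_of_nonneg_left (by linarith [hl.2]) hC.le)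
      refine ⟨(l, fun n => truncFrac c l (N - n) n, fun n => truncFrac d l (N - n) n),
        ⟨hl, fun n _ => ?_, fun n _ => ?_⟩, fun n hn => truncFrac_mul hc hl.1 hn,
        fun n hn => truncFrac_mul hd hl.1 hn, hl0⟩
      · exact Set.Icc_subset_Icc_left hsl (truncFrac_mem_Icc hc hl.1 _ _)
      · exact Set.Icc_subset_Icc_left hsl (truncFrac_mem_Icc hd hl.1 _ _))
    (hK.inter_right (hE 0)) (fun N => hK.isClosed.inter (hE N))
  rw [Set.mem_iInter] at hx
  have hu : ∀ n, 0 < u n := fun n => hs0.trans_le ((hx 0).1.2.1 n trivial).1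
  have hv : ∀ n, 0 < v n := fun n => hs0.trans_le ((hx 0).1.2.2 n trivial).1
  have hsum : u 0 + v 0 = l * e := (hx 0).2.2.2
  refine ⟨l, ?_, u, v, hu, hv, fun n => (hx (n + 1)).2.1 n n.lt_succ_self,
    fun n => (hx (n + 1)).2.2.1 n n.lt_succ_self, hsum⟩
  exact pos_of_mul_pos_left (hsum ▸ add_pos (hu 0) (hv 0)) he.le

lemma prod_sub_prod_of_continued_fraction {c u : ℕ → ℝ} {l : ℝ}
    (h : ∀ n, u n * (l * c n + u (n + 1)) = 1) (n : ℕ) :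
    ∏ i ∈ Finset.range n, u i - ∏ i ∈ Finset.range (n + 2), u i =
      l * (c n * ∏ i ∈ Finset.range (n + 1), u i) := by
  simp only [Finset.prod_range_succ]
  linear_combination (-∏ i ∈ Finset.range n, u i) * h n

lemma summable_sq_of_continued_fraction {c u : ℕ → ℝ} {l : ℝ} (hl : 0 < l)
    (hc : ∀ n, 0 ≤ c n) (hu : ∀ n, 0 < u n) (h : ∀ n, u n * (l * c n + u (n + 1)) = 1) :
    Summable fun n => (c n * ∏ i ∈ Finset.range (n + 1), u i) ^ 2 := by
  have hz : ∀ n, 0 < ∏ i ∈ Finset.range n, u i := fun n => Finset.prod_pos fun i _ => hu i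
  have hw : ∀ n, 0 ≤ c n * ∏ i ∈ Finset.range (n + 1), u i := fun n =>
    mul_nonneg (hc n) (hz _).le
  have htel : ∀ N, l * ∑ n ∈ Finset.range N, c n * ∏ i ∈ Finset.range (n + 1), u i =
      1 + u 0 - ∏ i ∈ Finset.range N, u i - ∏ i ∈ Finset.range (N + 1), u i := fun N => by
    induction N with
    | zero => simp
    | succ N ih =>
      rw [Finset.sum_range_succ, mul_add, ih, ← prod_sub_prod_of_continued_fraction h]
      ring
  have hsum : Summable fun n => c n * ∏ i ∈ Finset.range (n + 1), u i := by
    refine summable_of_sum_range_le (c := (1 + u 0) / l) hw fun N => ?_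
    rw [le_div_iff₀' hl, htel]
    linarith [hz N, hz (N + 1)]
  refine Summable.of_nonneg_of_le (fun n => sq_nonneg _) (fun n => ?_)
    (hsum.mul_left (∑' n, c n * ∏ i ∈ Finset.range (n + 1), u i))
  rw [sq]
  exact mul_le_mul_of_nonneg_right (hsum.le_tsum n fun m _ => hw m) (hw n)

/-- A three-term operator `w ↦ (r_{n-1} w_{n-1} - r_{n+1} w_{n+1})_n` whose only negative
coefficient is `r_0` has a positive eigenvalue. -/
lemma exists_pos_eigenvalue {r : ℤ → ℝ} {δ : ℝ} (hδ : 0 < δ) (h0 : r 0 < 0)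
    (hr : ∀ n, n ≠ 0 → r n ∈ Set.Icc δ 1) :
    ∃ lam : ℝ, 0 < lam ∧ ∃ w : ℤ → ℝ,
      Summable (fun n : ℤ => (w n) ^ 2) ∧ w ≠ 0 ∧
      ∀ n : ℤ, r (n - 1) * w (n - 1) - r (n + 1) * w (n + 1) = lam * w n := by
  have hinv : ∀ n, n ≠ 0 → (r n)⁻¹ ∈ Set.Icc 1 δ⁻¹ := fun n hn =>
    ⟨(one_le_inv₀ (hδ.trans_le (hr n hn).1)).2 (hr n hn).2, inv_anti₀ hδ (hr n hn).1⟩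
  have hrne : ∀ n, r n ≠ 0 := fun n => by
    rcases eq_or_ne n 0 with rfl | hn
    · exact h0.ne
    · exact (hδ.trans_le (hr n hn).1).ne'
  have hc : ∀ n : ℕ, (r (n + 1))⁻¹ ∈ Set.Icc 1 δ⁻¹ := fun n => hinv _ (by omega)
  have hd : ∀ n : ℕ, (r (-(n + 1)))⁻¹ ∈ Set.Icc 1 δ⁻¹ := fun n => hinv _ (by omega)
  obtain ⟨l, hl, u, v, hu, hv, hcu, hdv, huv⟩ :=
    exists_matched_continued_fractions hc hd (e := -(r 0)⁻¹) (by simpa using h0)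
  let z : ℤ → ℝ := fun n => if 0 ≤ n then ∏ i ∈ Finset.range n.toNat, u i
    else (-1) ^ (-n).toNat * ∏ i ∈ Finset.range (-n).toNat, v i
  have hzp : ∀ n : ℕ, z n = ∏ i ∈ Finset.range n, u i := fun n => by simp [z]
  have hzn : ∀ n : ℕ, z (-n) = (-1) ^ n * ∏ i ∈ Finset.range n, v i := fun n => by
    rcases n with _ | n
    · simp [z]
    · have : ¬ (0 : ℤ) ≤ -((n + 1 : ℕ) : ℤ) := by omega
      simp only [z, if_neg this, neg_neg, Int.toNat_natCast]
  have hrz : ∀ n, r n * ((r n)⁻¹ * z n) = z n := fun n => mul_inv_cancel_left₀ (hrne n) _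
  refine ⟨l, hl, fun n => (r n)⁻¹ * z n, ?_, fun h => ?_, fun n => ?_⟩
  · refine Summable.of_nat_of_neg ((summable_nat_add_iff 1).1 ?_) ((summable_nat_add_iff 1).1 ?_)
    · refine (summable_sq_of_continued_fraction hl (fun n => ?_) hu hcu).congr fun n => ?_
      · linarith [(hc n).1]
      · simp only [hzp]
        push_cast
        rfl
    · refine (summable_sq_of_continued_fraction hl (fun n => ?_) hv hdv).congr fun n => ?_
      · linarith [(hd n).1]
      · simp only [hzn]
        push_cast
        simp only [mul_pow, ← pow_mul, mul_comm _ 2]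
        simp [pow_mul]
  · have := congrFun h 0
    have hz0 : z 0 = 1 := by simp [z]
    simp [hz0, hrne 0] at this
  · simp only [hrz]
    obtain ⟨k, hk | hk⟩ : ∃ k : ℕ, n = k ∨ n = -((k + 1 : ℕ) : ℤ) := by
      rcases n with k | k
      · exact ⟨k, .inl rfl⟩
      · exact ⟨k, .inr rfl⟩
    · rcases k with _ | k
      · have h1 := hzp 1
        have h2 := hzn 1
        have h3 := hzp 0
        simp only [Nat.cast_one, Nat.cast_zero, Finset.prod_range_one, Finset.prod_range_zero,
          pow_one] at h1 h2 h3
        subst hk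
        simp only [Nat.cast_zero, zero_sub, zero_add, h1, h2, h3]
        linear_combination -huv
      · subst hk
        have h1 := prod_sub_prod_of_continued_fraction hcu k
        rw [← hzp, ← hzp, ← hzp] at h1
        push_cast at h1 ⊢
        rw [add_sub_cancel_right, add_assoc]
        exact h1
    · subst hk
      have h1 := prod_sub_prod_of_continued_fraction hdv k
      have e1 : -((k + 1 : ℕ) : ℤ) - 1 = -((k + 2 : ℕ) : ℤ) := by push_cast; ring
      have e2 : -((k + 1 : ℕ) : ℤ) + 1 = -(k : ℤ) := by push_cast; ring
      rw [e1, e2, hzn, hzn, hzn]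
      push_cast
      linear_combination (-(-1) ^ k) * h1

lemma znorm_sq (v : ℤ × ℤ) : znorm v ^ 2 = ((v.1 ^ 2 + v.2 ^ 2 : ℤ) : ℝ) := by
  rw [znorm, Real.sq_sqrt (by positivity)]
  push_cast
  rfl

/-- If `q` is of type `I₀` relative to `p`, the operator `L_{B,q}` has a positive
eigenvalue, hence the unidirectional flow is linearly unstable. -/
theorem unidirectional_instability_typeI0
    (p q : ℤ × ℤ) (hwedge : wedge q p ≠ 0) (α : ℝ) (hα : 0 ≤ α)
    (hq : znorm q < znorm p)
    (hn : ∀ n : ℤ, n ≠ 0 → znorm p < znorm (q + n • p)) :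
    ∃ lam : ℝ, 0 < lam ∧ ∃ w : ℤ → ℝ,
      Summable (fun n : ℤ => (w n) ^ 2) ∧ w ≠ 0 ∧
      ∀ n : ℤ, rho p q α (n - 1) * w (n - 1) - rho p q α (n + 1) * w (n + 1) = lam * w n := by
  have hnn : ∀ v, 0 ≤ znorm v := fun v => Real.sqrt_nonneg _
  have hP : 0 ≤ znorm p ^ 2 := sq_nonneg _
  refine exists_pos_eigenvalue (δ := 1 / (znorm p ^ 2 + 1)) (by positivity) ?_ fun n h => ?_
  · have hqpos : 0 < znorm q ^ 2 := by
      refine pow_pos (lt_of_le_of_ne (hnn q) fun h => hwedge ?_) 2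
      have h1 := znorm_sq q
      rw [← h, zero_pow two_ne_zero] at h1
      have h2 : q.1 ^ 2 + q.2 ^ 2 = 0 := by exact_mod_cast h1.symm
      have h3 : q.1 = 0 := by nlinarith [sq_nonneg q.1, sq_nonneg q.2]
      have h4 : q.2 = 0 := by nlinarith [sq_nonneg q.1, sq_nonneg q.2]
      simp [wedge, h3, h4]
    have hlt : znorm q ^ 2 < znorm p ^ 2 := pow_lt_pow_left₀ hq (hnn q) two_ne_zero
    rw [rho, zero_smul, add_zero, sub_neg, one_lt_div (by positivity)]
    exact mul_lt_mul hlt (by gcongr) (by positivity) hP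
  · have hlt : znorm p ^ 2 + 1 ≤ znorm (q + n • p) ^ 2 := by
      have h1 := pow_lt_pow_left₀ (hn n h) (hnn p) two_ne_zero
      rw [znorm_sq, znorm_sq] at h1 ⊢
      exact_mod_cast h1
    rw [rho]
    generalize znorm p ^ 2 = P at *
    generalize znorm (q + n • p) ^ 2 = Q at *
    have hQ : 0 < Q := by linarith
    refine ⟨?_, sub_le_self _ (by positivity)⟩
    have h2 : P * (1 + α ^ 2 * P) / (Q * (1 + α ^ 2 * Q)) ≤ P / (P + 1) := by
      rw [div_le_div_iff₀ (by positivity) (by positivity)]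
      have h3 : 1 + α ^ 2 * P ≤ 1 + α ^ 2 * Q := by gcongr; linarith
      calc P * (1 + α ^ 2 * P) * (P + 1) ≤ P * (1 + α ^ 2 * Q) * Q := by gcongr
        _ = P * (Q * (1 + α ^ 2 * Q)) := by ring
    have h4 : 1 / (P + 1) = 1 - P / (P + 1) := by field_simp; ring
    linarith
end

section
/- Let p, q ∈ ℤ² with q ∧ p ≠ 0, let α ≥ 0, and assume q is of type I₊ relative to p, i.e. ‖q‖ < ‖p‖, ‖q + p‖ = ‖p‖, and ‖q + n·p‖ > ‖p‖ for every integer n ∉ {0,1}. Then there exist a real number λ > 0 and a square-summable sequence w : ℤ → ℝ, not identically zero, such that ρ_{n−1} w_{n−1} − ρ_{n+1} w_{n+1} = λ w_n for all n ∈ ℤ. -/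
open Filter Topology

/-- The solution of `x (m + 2) = x m - s (m + 1) * b (m + 1) * x (m + 1)` with `x 0 = 1`, `x 1 = c`,
where `s` is `1` at even and `t` at odd indices. -/
noncomputable def alternatingRec (b : ℕ → ℝ) (c t : ℝ) : ℕ → ℝ
  | 0 => 1
  | 1 => c
  | m + 2 => alternatingRec b c t m -
      (if Even (m + 1) then 1 else t) * b (m + 1) * alternatingRec b c t (m + 1)

theorem continuous_alternatingRec (b : ℕ → ℝ) (c : ℝ) (m : ℕ) :
    Continuous fun t => alternatingRec b c t m := by
  induction m using Nat.twoStepInduction with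
  | zero => simpa [alternatingRec] using continuous_const
  | one => simpa [alternatingRec] using continuous_const
  | more m h₀ h₁ =>
    simp only [alternatingRec]
    split_ifs <;> fun_prop

/-- Along `x (m + 2) = x m - d m * x (m + 1)` with `d ≥ 0` and `x 0 ≥ 0`, all negative
terms have indices of the same parity. -/
theorem even_add_of_neg_of_neg {x d : ℕ → ℝ} (hd : ∀ m, 0 ≤ d m)
    (hx : ∀ m, x (m + 2) = x m - d m * x (m + 1)) (h₀ : 0 ≤ x 0)
    {i j : ℕ} (hi : x i < 0) (hj : x j < 0) : Even (i + j) := by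
  classical
  have hex : ∃ m, x m < 0 := ⟨i, hi⟩
  obtain ⟨m, hm, hlt⟩ : ∃ m, x m < 0 ∧ ∀ l < m, 0 ≤ x l :=
    ⟨Nat.find hex, Nat.find_spec hex, fun l hl => not_lt.1 (Nat.find_min hex hl)⟩
  obtain ⟨m, rfl⟩ : ∃ k, m = k + 1 := by
    refine Nat.exists_eq_succ_of_ne_zero ?_
    rintro rfl
    exact absurd hm (not_lt.2 h₀)
  have key : ∀ k, x (m + 1 + 2 * k) < 0 ∧ 0 ≤ x (m + 2 + 2 * k) := by
    intro k
    induction k with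
    | zero =>
      refine ⟨hm, ?_⟩
      have := mul_nonneg (hd m) (neg_nonneg.2 hm.le)
      have := hlt m (Nat.lt_succ_self m)
      have := hx m
      simp only [mul_zero, add_zero]
      linarith
    | succ k ih =>
      have e₁ := hx (m + 1 + 2 * k)
      have e₂ := hx (m + 2 + 2 * k)
      rw [show m + 1 + 2 * k + 1 = m + 2 + 2 * k by ring,
        show m + 1 + 2 * k + 2 = m + 1 + 2 * (k + 1) by ring] at e₁
      rw [show m + 2 + 2 * k + 1 = m + 1 + 2 * (k + 1) by ring,
        show m + 2 + 2 * k + 2 = m + 2 + 2 * (k + 1) by ring] at e₂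
      have := mul_nonneg (hd (m + 1 + 2 * k)) ih.2
      have hneg : x (m + 1 + 2 * (k + 1)) < 0 := by linarith [ih.1]
      have := mul_nonneg (hd (m + 2 + 2 * k)) (neg_nonneg.2 hneg.le)
      exact ⟨hneg, by linarith [ih.2]⟩
  have parity : ∀ l, x l < 0 → Even (l + (m + 1)) := by
    intro l hl
    by_contra hodd
    have hle : m + 1 ≤ l := by
      by_contra! h
      exact absurd hl (not_lt.2 (hlt l h))
    rw [Nat.not_even_iff_odd] at hodd
    obtain ⟨k, hk⟩ : ∃ k, l = m + 2 + 2 * k := by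
      obtain ⟨r, hr⟩ := hodd
      exact ⟨r - (m + 1), by omega⟩
    exact absurd (hk ▸ hl) (not_lt.2 (key k).2)
  have hpi := parity i hi
  have hpj := parity j hj
  rw [Nat.even_iff] at *
  omega

theorem alternatingRec_zero_even (b : ℕ → ℝ) (c : ℝ) (k : ℕ) :
    alternatingRec b c 0 (2 * k) = 1 := by
  induction k with
  | zero => simp [alternatingRec]
  | succ k ih => simp [mul_add, alternatingRec, ih]

theorem alternatingRec_zero_odd_le {b : ℕ → ℝ} (hb : ∀ m, 1 ≤ b (m + 1)) (c : ℝ) (k : ℕ) :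
    alternatingRec b c 0 (2 * k + 1) ≤ c - k := by
  induction k with
  | zero => simp [alternatingRec]
  | succ k ih =>
    have h := alternatingRec_zero_even b c (k + 1)
    have hbk := hb (2 * k + 1)
    rw [mul_add, mul_one] at h
    have e : alternatingRec b c 0 (2 * (k + 1) + 1) =
        alternatingRec b c 0 (2 * k + 1) - b (2 * k + 1 + 1) := by
      rw [show 2 * (k + 1) + 1 = 2 * k + 1 + 2 by ring, alternatingRec,
        if_pos (by rw [Nat.even_iff]; omega), h]
      ring
    rw [e]
    push_cast
    linarith

theorem exists_pos_alternatingRec_nonneg {b : ℕ → ℝ} (hb : ∀ m, 1 ≤ b (m + 1)) {c : ℝ}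
    (hc : 0 < c) : ∃ t, 0 < t ∧ ∀ m, 0 ≤ alternatingRec b c t m := by
  by_contra! hneg
  set A : Set ℝ := ⋃ k, {t | alternatingRec b c t (2 * k) < 0} with hA
  set B : Set ℝ := ⋃ k, {t | alternatingRec b c t (2 * k + 1) < 0} with hB
  have hAo : IsOpen A :=
    isOpen_iUnion fun k => isOpen_lt (continuous_alternatingRec b c _) continuous_const
  have hBo : IsOpen B :=
    isOpen_iUnion fun k => isOpen_lt (continuous_alternatingRec b c _) continuous_const
  have h0B : (0 : ℝ) ∈ B := by
    obtain ⟨k, hk⟩ := exists_nat_gt c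
    exact Set.mem_iUnion.2
      ⟨k, (alternatingRec_zero_odd_le hb c k).trans_lt (sub_neg.2 hk)⟩
  have hcover : Set.Ici (0 : ℝ) ⊆ A ∪ B := by
    intro t ht
    rcases (Set.mem_Ici.1 ht).eq_or_lt with rfl | ht
    · exact Or.inr h0B
    · obtain ⟨m, hm⟩ := hneg t ht
      rcases Nat.even_or_odd' m with ⟨k, rfl | rfl⟩
      · exact Or.inl (Set.mem_iUnion.2 ⟨k, hm⟩)
      · exact Or.inr (Set.mem_iUnion.2 ⟨k, hm⟩)
  have hAne : (Set.Ici (0 : ℝ) ∩ A).Nonempty := by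
    refine ⟨2 / c, (by positivity : (0 : ℝ) ≤ 2 / c), Set.mem_iUnion.2 ⟨1, ?_⟩⟩
    have h := hb 0
    have e : alternatingRec b c (2 / c) (2 * 1) = 1 - 2 * b (0 + 1) := by
      simp [alternatingRec]
      field_simp
    simp only [Set.mem_ofPred_eq, e]
    linarith
  obtain ⟨t, ht, htA, htB⟩ := isPreconnected_Ici A B hAo hBo hcover hAne
    ⟨0, Set.self_mem_Ici, h0B⟩
  obtain ⟨i, hi⟩ := Set.mem_iUnion.1 htA
  obtain ⟨j, hj⟩ := Set.mem_iUnion.1 htB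
  have hd : ∀ m, 0 ≤ (if Even (m + 1) then 1 else t) * b (m + 1) := fun m =>
    mul_nonneg (by split_ifs; exacts [zero_le_one, ht]) (zero_le_one.trans (hb m))
  have := even_add_of_neg_of_neg (x := alternatingRec b c t) hd (fun m => rfl)
    (by simp [alternatingRec]) hi hj
  rw [Nat.even_iff] at this
  omega

/-- The recurrence `u (m + 2) = u m - lam * b (m + 1) * u (m + 1)` with `u 0 = 1`, `u 1 = lam * c`
has a nonnegative solution for some `lam > 0`. -/
theorem exists_nonneg_recurrence_solution {b : ℕ → ℝ} (hb : ∀ m, 1 ≤ b (m + 1)) {c : ℝ}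
    (hc : 0 < c) : ∃ lam : ℝ, 0 < lam ∧ ∃ u : ℕ → ℝ, u 0 = 1 ∧ u 1 = lam * c ∧
      (∀ m, 0 ≤ u m) ∧ ∀ m, u (m + 2) = u m - lam * b (m + 1) * u (m + 1) := by
  obtain ⟨t, ht, hnn⟩ := exists_pos_alternatingRec_nonneg hb hc
  have hs := Real.sq_sqrt ht.le
  refine ⟨√t, Real.sqrt_pos.2 ht,
    fun m => (if Even m then 1 else √t) * alternatingRec b c t m, ?_, ?_, fun m => ?_, fun m => ?_⟩
  · simp [alternatingRec]
  · simp [alternatingRec]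
  · exact mul_nonneg (by split_ifs; exacts [zero_le_one, Real.sqrt_nonneg t]) (hnn m)
  · by_cases hm : Even m
    · simp only [alternatingRec, hm, Nat.even_add_one, not_true_eq_false, not_false_eq_true,
        if_true, if_false]
      linear_combination b (m + 1) * alternatingRec b c t (m + 1) * hs
    · simp only [alternatingRec, hm, Nat.even_add_one, not_true_eq_false, not_false_eq_true,
        if_true, if_false]
      ring

theorem summable_of_nonneg_recurrence {u b : ℕ → ℝ} {lam : ℝ} (hlam : 0 < lam)
    (hb : ∀ m, 0 ≤ b (m + 1)) (hu : ∀ m, 0 ≤ u m)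
    (hrec : ∀ m, u (m + 2) = u m - lam * b (m + 1) * u (m + 1)) :
    Summable fun m => b m * u m := by
  rw [← summable_nat_add_iff 1]
  refine summable_of_sum_range_le (c := (u 0 + u 1) / lam)
    (fun m => mul_nonneg (hb m) (hu _)) fun n => ?_
  have htel : lam * ∑ m ∈ Finset.range n, b (m + 1) * u (m + 1) =
      u 0 + u 1 - u n - u (n + 1) := by
    induction n with
    | zero => simp
    | succ n ih =>
      rw [Finset.sum_range_succ, mul_add, ih]
      linear_combination hrec n
  rw [le_div_iff₀' hlam, htel]
  linarith [hu n, hu (n + 1)]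

theorem exists_eigensequence {r : ℤ → ℝ} (h₀ : r 0 < 0) (h₁ : r 1 = 0)
    (hpos : ∀ m : ℕ, 0 < r (-(m + 1 : ℤ))) (hle : ∀ m : ℕ, r (-(m + 1 : ℤ)) ≤ 1) :
    ∃ lam : ℝ, 0 < lam ∧ ∃ w : ℤ → ℝ, Summable (fun n : ℤ => w n ^ 2) ∧ w ≠ 0 ∧
      ∀ n : ℤ, r (n - 1) * w (n - 1) - r (n + 1) * w (n + 1) = lam * w n := by
  set b : ℕ → ℝ := fun m => (r (-(m : ℤ)))⁻¹ with hbdef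
  have hb : ∀ m, 1 ≤ b (m + 1) := fun m => by
    simp only [hbdef]
    push_cast
    exact (one_le_inv₀ (hpos m)).2 (hle m)
  obtain ⟨lam, hlam, u, hu0, hu1, hu, hrec⟩ :=
    exists_nonneg_recurrence_solution hb (c := -(r 0)⁻¹) (neg_pos.2 (inv_lt_zero.2 h₀))
  have hsum : Summable fun m => b m * u m :=
    summable_of_nonneg_recurrence hlam (fun m => zero_le_one.trans (hb m)) hu hrec
  have hr : ∀ m : ℕ, r (-(m : ℤ)) ≠ 0 := by
    rintro (_ | m)
    · simpa using h₀.ne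
    · exact_mod_cast (hpos m).ne'
  set w : ℤ → ℝ := fun n =>
    if n ≤ 0 then (-1) ^ n.natAbs * (b n.natAbs * u n.natAbs) else if n = 1 then lam⁻¹ else 0
    with hw
  have hwneg : ∀ m : ℕ, w (-(m : ℤ)) = (-1) ^ m * (b m * u m) := fun m => by simp [hw]
  have hw1 : w 1 = lam⁻¹ := by simp [hw]
  have hw2 : ∀ n : ℤ, 2 ≤ n → w n = 0 := fun n hn => by
    simp only [hw]
    rw [if_neg (by omega), if_neg (by omega)]
  have hz : ∀ m : ℕ, r (-(m : ℤ)) * w (-(m : ℤ)) = (-1) ^ m * u m := fun m => by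
    have := hr m
    rw [hwneg]
    simp only [hbdef]
    field_simp
  have hz0 : r 0 * w 0 = 1 := by simpa [hu0] using hz 0
  have hz1 : r (-1) * w (-1) = lam * (r 0)⁻¹ := by simpa [hu1] using hz 1
  refine ⟨lam, hlam, w, ?_, ?_, fun n => ?_⟩
  · refine Summable.of_nat_of_neg ?_ ?_
    · rw [← summable_nat_add_iff 2]
      have : (fun m : ℕ => w ((m + 2 : ℕ) : ℤ) ^ 2) = fun _ => 0 := by
        funext m
        rw [hw2 _ (by push_cast; omega)]
        norm_num
      rw [this]
      exact summable_zero
    · have : (fun m : ℕ => w (-(m : ℤ)) ^ 2) = fun m => (b m * u m) * (b m * u m) := by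
        funext m
        rw [hwneg, mul_pow, ← pow_mul, mul_comm m 2, pow_mul]
        norm_num
        ring
      rw [this]
      have hnorm := hsum.norm
      exact .of_norm ((hnorm.mul_of_nonneg hnorm (fun _ => norm_nonneg _)
        (fun _ => norm_nonneg _)).comp_injective (i := fun m : ℕ => (m, m))
        (fun _ _ h => (Prod.mk.inj h).1) |>.congr fun m => (norm_mul _ _).symm)
  · intro h
    simp [h] at hz0
  · have hcases : n ≤ -1 ∨ n = 0 ∨ n = 1 ∨ n = 2 ∨ 3 ≤ n := by omega
    rcases hcases with hn | rfl | rfl | rfl | hn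
    · obtain ⟨m, rfl⟩ : ∃ m : ℕ, n = -((m + 1 : ℕ) : ℤ) := ⟨(-n - 1).toNat, by omega⟩
      rw [show -((m + 1 : ℕ) : ℤ) - 1 = -((m + 2 : ℕ) : ℤ) by push_cast; ring,
        show -((m + 1 : ℕ) : ℤ) + 1 = -(m : ℤ) by push_cast; ring, hz, hz, hwneg, hrec]
      ring
    · have hw0 : w 0 = (r 0)⁻¹ := eq_inv_of_mul_eq_one_right hz0
      simp [h₁, hz1, hw0]
    · simp [hz0, hw2 2 le_rfl, hw1, hlam.ne']
    · simp [h₁, hw2 3 (by norm_num), hw2 2 le_rfl]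
    · rw [hw2 (n - 1) (by omega), hw2 (n + 1) (by omega), hw2 n (by omega)]
      ring

theorem sq_mul_one_add_lt {α x y : ℝ} (hx : 0 ≤ x) (hxy : x < y) :
    x ^ 2 * (1 + α ^ 2 * x ^ 2) < y ^ 2 * (1 + α ^ 2 * y ^ 2) := by
  have h : x ^ 2 < y ^ 2 := by gcongr
  have h' : 1 + α ^ 2 * x ^ 2 ≤ 1 + α ^ 2 * y ^ 2 := by gcongr
  exact mul_lt_mul h h' (by positivity) (by positivity)

theorem znorm_pos {v : ℤ × ℤ} (hv : v ≠ 0) : 0 < znorm v := by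
  refine Real.sqrt_pos.2 ?_
  contrapose! hv
  have h₁ : (v.1 : ℝ) = 0 := by nlinarith [sq_nonneg (v.1 : ℝ), sq_nonneg (v.2 : ℝ)]
  have h₂ : (v.2 : ℝ) = 0 := by nlinarith [sq_nonneg (v.1 : ℝ), sq_nonneg (v.2 : ℝ)]
  exact Prod.ext (by exact_mod_cast h₁) (by exact_mod_cast h₂)

/-- If `q` is of type `I₊` relative to `p`, the operator `L_{B,q}` has a positive
eigenvalue. -/
theorem unidirectional_instability_typeIplus
    (p q : ℤ × ℤ) (hwedge : wedge q p ≠ 0) (α : ℝ) (hα : 0 ≤ α)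
    (hq : znorm q < znorm p)
    (hqp : znorm (q + p) = znorm p)
    (hn : ∀ n : ℤ, n ≠ 0 → n ≠ 1 → znorm p < znorm (q + n • p)) :
    ∃ lam : ℝ, 0 < lam ∧ ∃ w : ℤ → ℝ,
      Summable (fun n : ℤ => (w n) ^ 2) ∧ w ≠ 0 ∧
      ∀ n : ℤ, rho p q α (n - 1) * w (n - 1) - rho p q α (n + 1) * w (n + 1) = lam * w n := by
  have hqpos : 0 < znorm q := znorm_pos (by rintro rfl; simp [wedge] at hwedge)
  have hppos : 0 < znorm p := hqpos.trans hq
  have hlt : ∀ m : ℕ, znorm p < znorm (q + (-(m + 1 : ℤ)) • p) := fun m =>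
    hn _ (by omega) (by omega)
  refine exists_eigensequence ?_ ?_ (fun m => ?_) fun m => ?_
  · have h := sq_mul_one_add_lt (α := α) hqpos.le hq
    simp only [rho, zero_smul, add_zero]
    rw [sub_neg, one_lt_div (by positivity)]
    exact h
  · simp only [rho, one_smul, hqp]
    rw [div_self (by positivity), sub_self]
  · have h := sq_mul_one_add_lt (α := α) hppos.le (hlt m)
    have hpos := hppos.trans (hlt m)
    simp only [rho]
    rw [sub_pos, div_lt_one (by positivity)]
    exact h
  · exact sub_le_self _ (by positivity)
end

section
/- Let p, q ∈ ℤ² with q ∧ p ≠ 0, let α ≥ 0, and assume q is of type I₀ relative to p, i.e. ‖q‖ < ‖p‖ and ‖q + n·p‖ > ‖p‖ for every integer n ≠ 0. Then for every λ > 0 the limits f(λ) = lim_{k→∞} [λ/ρ₁, λ/ρ₂, …, λ/ρ_k] and g(λ) = lim_{k→∞} [λ/ρ_{−1}, λ/ρ_{−2}, …, λ/ρ_{−k}] exist, and a real number λ > 0 admits a square-summable sequence w : ℤ → ℝ satisfying ρ_{n−1} w_{n−1} − ρ_{n+1} w_{n+1} = λ w_n for all n ∈ ℤ together with the sign pattern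 I₀ if and only if λ/ρ₀ + f(λ) + g(λ) = 0. -/
open Filter Topology

/-- Finite continued fraction `[a₁, …, a_k]`, defined by `[a_k] = 1/a_k` and
`[a_j, …, a_k] = 1/(a_j + [a_{j+1}, …, a_k])` (with the empty fraction equal to `0`). -/
noncomputable def cfrac : List ℝ → ℝ
  | [] => 0
  | a :: l => 1 / (a + cfrac l)

/-- Sign pattern `I₀` (one of the two branches): `w_n > 0` for `n ≥ 1`, `w₀ < 0`,
`w_{−1} < 0`, and `(−1)^{|n|} w_n > 0` for `n ≤ −2`. -/
def SignI0aux (w : ℤ → ℝ) : Prop :=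
  (∀ n : ℤ, 1 ≤ n → 0 < w n) ∧ w 0 < 0 ∧ w (-1) < 0 ∧
    ∀ n : ℤ, n ≤ -2 → 0 < (-1 : ℝ) ^ n.natAbs * w n

/-- A sequence satisfies the sign pattern `I₀` if either it or its negative satisfies
the inequalities of `SignI0aux`. -/
def SignI0 (w : ℤ → ℝ) : Prop := SignI0aux w ∨ SignI0aux (fun n => -w n)

/-- The continued fraction with partial denominators `a 0, …, a (k - 1)` and tail `t`, i.e.
`1 / (a 0 + 1 / (a 1 + ⋯ + 1 / (a (k - 1) + t)))`. -/
noncomputable def cfracTail : ℕ → (ℕ → ℝ) → ℝ → ℝ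
  | 0, _, t => t
  | k + 1, a, t => 1 / (a 0 + cfracTail k (fun i => a (i + 1)) t)

theorem cfrac_map_range (k : ℕ) (a : ℕ → ℝ) :
    cfrac ((List.range k).map a) = cfracTail k a 0 := by
  induction k generalizing a with
  | zero => simp [cfrac, cfracTail]
  | succ k ih =>
    rw [List.range_succ_eq_map, List.map_cons, List.map_map, cfrac, cfracTail, ← ih]
    rfl

theorem cfracTail_add (k j : ℕ) (a : ℕ → ℝ) (t : ℝ) :
    cfracTail (k + j) a t = cfracTail k a (cfracTail j (fun i => a (i + k)) t) := by
  induction k generalizing a with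
  | zero => simp [cfracTail]
  | succ k ih =>
    rw [Nat.add_right_comm, cfracTail, cfracTail, ih]
    simp only [add_assoc]

theorem cfracTail_nonneg {a : ℕ → ℝ} (ha : ∀ i, 0 < a i) (k : ℕ) {t : ℝ} (ht : 0 ≤ t) :
    0 ≤ cfracTail k a t := by
  induction k generalizing a with
  | zero => exact ht
  | succ k ih =>
    have h := ih (a := fun i => a (i + 1)) fun i => ha _
    have := ha 0
    rw [cfracTail]
    positivity

theorem eq_cfracTail_of_recurrence {a r : ℕ → ℝ} (hr : ∀ m, r m = 1 / (a m + r (m + 1)))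
    (k : ℕ) : r 0 = cfracTail k a (r k) := by
  induction k generalizing a r with
  | zero => rfl
  | succ k ih =>
    rw [cfracTail, ← ih (a := fun i => a (i + 1)) (r := fun i => r (i + 1)) fun m => hr _]
    exact hr 0

theorem abs_sub_le_of_mem_Icc_zero {u v C : ℝ} (hu : 0 ≤ u) (hv : 0 ≤ v) (hu' : u ≤ C)
    (hv' : v ≤ C) : |u - v| ≤ C := by
  rw [abs_le]
  constructor <;> linarith

/-- Two steps of the continued fraction recursion contract distances. -/
theorem abs_sub_two_steps_le {δ a b u v : ℝ} (hδ : 0 < δ) (ha : δ ≤ a) (hb : δ ≤ b)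
    (hu : 0 ≤ u) (hv : 0 ≤ v) :
    |1 / (a + 1 / (b + u)) - 1 / (a + 1 / (b + v))| ≤ 1 / (1 + δ ^ 2) * |u - v| := by
  have ha0 : 0 < a := hδ.trans_le ha
  have hb0 : 0 < b := hδ.trans_le hb
  have hden : ∀ x : ℝ, 0 ≤ x → 1 + δ ^ 2 ≤ a * (b + x) + 1 := fun x hx => by
    nlinarith [mul_le_mul ha hb hδ.le ha0.le, mul_nonneg ha0.le hx]
  have hU := hden u hu
  have hV := hden v hv
  have hδ2 : 0 < δ ^ 2 := by positivity
  have hU0 : 0 < a * (b + u) + 1 := by linarith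
  have hV0 : 0 < a * (b + v) + 1 := by linarith
  have key : 1 / (a + 1 / (b + u)) - 1 / (a + 1 / (b + v)) =
      1 / ((a * (b + u) + 1) * (a * (b + v) + 1)) * (u - v) := by
    have hbu : 0 < b + u := by linarith
    have hbv : 0 < b + v := by linarith
    field_simp
    ring
  rw [key, abs_mul, abs_of_pos (by positivity)]
  refine mul_le_mul_of_nonneg_right ?_ (abs_nonneg _)
  apply one_div_le_one_div_of_le (by linarith)
  nlinarith

theorem abs_cfracTail_sub_le {δ : ℝ} (hδ : 0 < δ) (k : ℕ) {a : ℕ → ℝ} (ha : ∀ i, δ ≤ a i)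
    {s t : ℝ} (hs : 0 ≤ s) (ht : 0 ≤ t) :
    |cfracTail (k + 1) a s - cfracTail (k + 1) a t| ≤ (1 / (1 + δ ^ 2)) ^ (k / 2) * (1 / δ) := by
  have hpos : ∀ i, 0 < a i := fun i => hδ.trans_le (ha i)
  have hle : ∀ j {x : ℝ}, 0 ≤ x → cfracTail (j + 1) a x ≤ 1 / δ := fun j x hx => by
    rw [cfracTail]
    apply one_div_le_one_div_of_le hδ
    linarith [ha 0, cfracTail_nonneg (a := fun i => a (i + 1)) (fun i => hpos _) j hx]
  induction k using Nat.twoStepInduction generalizing a with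
  | zero =>
    simpa using abs_sub_le_of_mem_Icc_zero (cfracTail_nonneg hpos _ hs)
      (cfracTail_nonneg hpos _ ht) (hle 0 hs) (hle 0 ht)
  | one =>
    simpa using abs_sub_le_of_mem_Icc_zero (cfracTail_nonneg hpos _ hs)
      (cfracTail_nonneg hpos _ ht) (hle 1 hs) (hle 1 ht)
  | more k ih _ =>
    have hpos' : ∀ i, 0 < a (i + 1 + 1) := fun i => hpos _
    have hle' : ∀ j {x : ℝ}, 0 ≤ x → cfracTail (j + 1) (fun i => a (i + 1 + 1)) x ≤ 1 / δ :=
      fun j x hx => by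
        rw [cfracTail]
        apply one_div_le_one_div_of_le hδ
        linarith [ha (0 + 1 + 1), cfracTail_nonneg (a := fun i => a (i + 1 + 1 + 1))
          (fun i => hpos _) j hx]
    have h := ih (a := fun i => a (i + 1 + 1)) (fun i => ha _) hpos' hle'
    have h2 := abs_sub_two_steps_le hδ (ha 0) (ha (0 + 1))
      (cfracTail_nonneg hpos' (k + 1) hs) (cfracTail_nonneg hpos' (k + 1) ht)
    have hdiv : (k + 2) / 2 = k / 2 + 1 := by omega
    rw [show k + 2 + 1 = k + 1 + 1 + 1 from rfl, cfracTail, cfracTail, cfracTail, cfracTail,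
      hdiv, pow_succ', mul_assoc]
    exact h2.trans (mul_le_mul_of_nonneg_left h (by positivity))

theorem tendsto_contraction_bound {δ : ℝ} (hδ : 0 < δ) :
    Tendsto (fun k : ℕ => (1 / (1 + δ ^ 2)) ^ (k / 2) * (1 / δ)) atTop (𝓝 0) := by
  have h1 : 1 / (1 + δ ^ 2) < 1 := by
    rw [div_lt_one (by positivity)]
    nlinarith
  have h := (tendsto_pow_atTop_nhds_zero_of_lt_one (by positivity) h1).comp
    (Nat.tendsto_div_const_atTop (n := 2) (by norm_num))
  simpa using h.mul_const (1 / δ)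

/-- A positive solution of the Riccati recurrence is the value of the continued fraction. -/
theorem tendsto_cfracTail_of_recurrence {δ : ℝ} (hδ : 0 < δ) {a r : ℕ → ℝ} (ha : ∀ i, δ ≤ a i)
    (hr0 : ∀ m, 0 < r m) (hr : ∀ m, r m = 1 / (a m + r (m + 1))) :
    Tendsto (fun k => cfracTail k a 0) atTop (𝓝 (r 0)) := by
  rw [← tendsto_add_atTop_iff_nat 1, tendsto_iff_norm_sub_tendsto_zero]
  refine squeeze_zero (fun _ => norm_nonneg _) (fun k => ?_) (tendsto_contraction_bound hδ)
  rw [Real.norm_eq_abs, eq_cfracTail_of_recurrence hr (k + 1)]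
  exact abs_cfracTail_sub_le hδ k ha le_rfl (hr0 _).le

theorem exists_tendsto_cfracTail {δ : ℝ} (hδ : 0 < δ) {a : ℕ → ℝ} (ha : ∀ i, δ ≤ a i) :
    ∃ L, Tendsto (fun k => cfracTail k a 0) atTop (𝓝 L) := by
  have hc : CauchySeq fun k => cfracTail (k + 1) a 0 := by
    refine cauchySeq_of_le_tendsto_0' _ (fun n m hnm => ?_) (tendsto_contraction_bound hδ)
    obtain ⟨j, rfl⟩ := Nat.exists_eq_add_of_le hnm
    rw [Real.dist_eq, Nat.add_right_comm, cfracTail_add (n + 1) j]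
    exact abs_cfracTail_sub_le hδ n ha le_rfl
      (cfracTail_nonneg (fun i => hδ.trans_le (ha _)) j le_rfl)
  obtain ⟨L, hL⟩ := cauchySeq_tendsto_of_complete hc
  exact ⟨L, (tendsto_add_atTop_iff_nat 1).1 hL⟩

theorem exists_pos_recurrence {δ : ℝ} (hδ : 0 < δ) {a : ℕ → ℝ} (ha : ∀ i, δ ≤ a i) :
    ∃ r : ℕ → ℝ, (∀ m, 0 < r m) ∧ ∀ m, r m = 1 / (a m + r (m + 1)) := by
  choose r hr using fun m => exists_tendsto_cfracTail hδ (a := fun i => a (i + m)) fun i => ha _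
  have hr0 : ∀ m, 0 ≤ r m := fun m => ge_of_tendsto' (hr m) fun k =>
    cfracTail_nonneg (fun i => hδ.trans_le (ha _)) k le_rfl
  have hpos : ∀ m, 0 < a m + r (m + 1) := fun m => by linarith [ha m, hr0 (m + 1)]
  have hrec : ∀ m, r m = 1 / (a m + r (m + 1)) := fun m => by
    refine tendsto_nhds_unique ((tendsto_add_atTop_iff_nat 1).2 (hr m)) ?_
    have h := tendsto_const_nhds (x := (1 : ℝ)).div ((hr (m + 1)).const_add (a m)) (hpos m).ne'
    refine h.congr fun k => ?_
    rw [cfracTail, Pi.div_apply]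
    simp only [zero_add, add_assoc, add_comm 1 m]
  exact ⟨r, fun m => by rw [hrec]; exact one_div_pos.2 (hpos m), hrec⟩

/-- The ratio of the first two terms of a positive solution of the three-term recurrence is the
value of the continued fraction. -/
theorem tendsto_cfrac_of_three_term {δ : ℝ} (hδ : 0 < δ) {a x : ℕ → ℝ} (ha : ∀ i, δ ≤ a i)
    (hx0 : ∀ m, 0 < x m) (hx : ∀ m, x m - x (m + 2) = a m * x (m + 1)) :
    Tendsto (fun k => cfrac ((List.range k).map a)) atTop (𝓝 (x 1 / x 0)) := by
  simp only [cfrac_map_range]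
  refine tendsto_cfracTail_of_recurrence hδ (r := fun m => x (m + 1) / x m) ha
    (fun m => div_pos (hx0 _) (hx0 _)) fun m => ?_
  have h1 := (hx0 (m + 1)).ne'
  have h : a m + x (m + 1 + 1) / x (m + 1) = x m / x (m + 1) := by
    rw [eq_div_iff h1, add_mul, div_mul_cancel₀ _ h1, ← hx m]
    ring
  rw [h, one_div_div]

/-- The three-term recurrence has a positive square-summable solution. -/
theorem exists_pos_three_term {δ : ℝ} (hδ : 0 < δ) {a : ℕ → ℝ} (ha : ∀ i, δ ≤ a i) :
    ∃ x : ℕ → ℝ, x 0 = 1 ∧ (∀ m, 0 < x m) ∧ (∀ m, x m - x (m + 2) = a m * x (m + 1)) ∧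
      Summable fun m => x m ^ 2 := by
  obtain ⟨r, hr0, hr⟩ := exists_pos_recurrence hδ ha
  set x : ℕ → ℝ := fun m => ∏ i ∈ Finset.range m, r i
  have hx0 : ∀ m, 0 < x m := fun m => Finset.prod_pos fun i _ => hr0 i
  have hx : ∀ m, x m - x (m + 2) = a m * x (m + 1) := fun m => by
    have hp : 0 < a m + r (m + 1) := by linarith [ha m, hr0 (m + 1)]
    have h : r m * (a m + r (m + 1)) = 1 := by
      rw [hr m, one_div_mul_cancel hp.ne']
    have h1 : x (m + 1) = x m * r m := Finset.prod_range_succ _ _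
    have h2 : x (m + 2) = x (m + 1) * r (m + 1) := Finset.prod_range_succ _ _
    rw [h2, h1]
    linear_combination -x m * h
  refine ⟨x, Finset.prod_range_zero _, hx0, hx, (summable_nat_add_iff 1).1 ?_⟩
  have hsum : ∀ n, δ * ∑ m ∈ Finset.range n, x (m + 1) ^ 2 ≤ x 0 * x 1 - x n * x (n + 1) := by
    intro n
    induction n with
    | zero => simp
    | succ n ih =>
      rw [Finset.sum_range_succ]
      have h := congrArg (· * x (n + 1)) (hx n)
      have h2 : δ * x (n + 1) ^ 2 ≤ a n * x (n + 1) ^ 2 :=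
        mul_le_mul_of_nonneg_right (ha n) (sq_nonneg _)
      rw [show n + 1 + 1 = n + 2 from rfl]
      linarith
  refine summable_of_sum_range_le (c := x 0 * x 1 / δ) (fun _ => sq_nonneg _) fun n => ?_
  rw [le_div_iff₀ hδ, mul_comm]
  linarith [hsum n, mul_pos (hx0 n) (hx0 (n + 1))]

theorem map_natCast_range (k : ℕ) (f : ℤ → ℝ) :
    List.map f (do let i ← List.range k; pure (i : ℤ)) = (List.range k).map fun i : ℕ => f i := by
  rw [List.map_eq_flatMap (l := List.range k)]
  simp [List.map_flatMap]

/-- `w` is in the kernel of `L - lam`, where `L` is the weighted difference operator with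
weights `ρ`. -/
def IsEigenseq (ρ : ℤ → ℝ) (lam : ℝ) (w : ℤ → ℝ) : Prop :=
  ∀ n : ℤ, ρ (n - 1) * w (n - 1) - ρ (n + 1) * w (n + 1) = lam * w n

section Weights

variable {ρ : ℤ → ℝ} {lam : ℝ}

theorem le_div_of_weight (hlam : 0 < lam) (hpos : ∀ n, n ≠ 0 → 0 < ρ n) (hle : ∀ n, ρ n ≤ 1)
    {n : ℤ} (hn : n ≠ 0) : lam ≤ lam / ρ n := by
  rw [le_div_iff₀ (hpos n hn)]
  nlinarith [hle n]

theorem sum_eq_zero_of_signI0aux (hlam : 0 < lam) (hpos : ∀ n, n ≠ 0 → 0 < ρ n)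
    (hneg : ρ 0 < 0) (hle : ∀ n, ρ n ≤ 1) {w : ℤ → ℝ} (hw : SignI0aux w)
    (heq : IsEigenseq ρ lam w) {F G : ℝ}
    (hF : Tendsto (fun k : ℕ => cfrac ((List.range k).map fun i : ℕ => lam / ρ ((i : ℤ) + 1)))
      atTop (𝓝 F))
    (hG : Tendsto (fun k : ℕ => cfrac ((List.range k).map fun i : ℕ => lam / ρ (-((i : ℤ) + 1))))
      atTop (𝓝 G)) :
    lam / ρ 0 + F + G = 0 := by
  obtain ⟨hw1, hw0, hwn1, hwn⟩ := hw
  have hx0 : ∀ m : ℕ, 0 < ρ m * w m := by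
    rintro (_ | m)
    · simpa using mul_pos_of_neg_of_neg hneg hw0
    · exact mul_pos (hpos _ (by omega)) (hw1 _ (by omega))
  have hy0 : ∀ m : ℕ, 0 < (-1) ^ m * (ρ (-m) * w (-m)) := by
    rintro (_ | _ | m)
    · simpa using mul_pos_of_neg_of_neg hneg hw0
    · simpa using mul_neg_of_pos_of_neg (hpos (-1) (by omega)) hwn1
    · have h := mul_pos (hpos (-((m + 2 : ℕ) : ℤ)) (by omega))
        (hwn (-((m + 2 : ℕ) : ℤ)) (by omega))
      rw [Int.natAbs_neg, Int.natAbs_natCast] at h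
      rwa [mul_left_comm] at h
  have hx : ∀ m : ℕ, ρ m * w m - ρ (m + 2 : ℕ) * w (m + 2 : ℕ) =
      lam / ρ ((m : ℤ) + 1) * (ρ (m + 1 : ℕ) * w (m + 1 : ℕ)) := fun m => by
    have h := heq (m + 1)
    have hρ := (hpos ((m : ℤ) + 1) (by omega)).ne'
    push_cast
    rw [← mul_assoc, div_mul_cancel₀ _ hρ, ← h, add_sub_cancel_right, add_assoc]
    norm_num
  have hy : ∀ m : ℕ, (-1) ^ m * (ρ (-m) * w (-m)) -
      (-1) ^ (m + 2) * (ρ (-(m + 2 : ℕ)) * w (-(m + 2 : ℕ))) =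
      lam / ρ (-((m : ℤ) + 1)) *
        ((-1) ^ (m + 1) * (ρ (-(m + 1 : ℕ)) * w (-(m + 1 : ℕ)))) := fun m => by
    have h := heq (-((m : ℤ) + 1))
    rw [show -((m : ℤ) + 1) - 1 = -((m : ℤ) + 2) by ring,
      show -((m : ℤ) + 1) + 1 = -(m : ℤ) by ring] at h
    have hρ := (hpos (-((m : ℤ) + 1)) (by omega)).ne'
    push_cast
    have h3 : lam / ρ (-((m : ℤ) + 1)) *
        ((-1) ^ (m + 1) * (ρ (-((m : ℤ) + 1)) * w (-((m : ℤ) + 1)))) =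
        (-1) ^ (m + 1) * (lam * w (-((m : ℤ) + 1))) := by
      field_simp
    rw [h3, ← h]
    ring
  have h1 := tendsto_cfrac_of_three_term hlam
    (fun i : ℕ => le_div_of_weight hlam hpos hle (n := (i : ℤ) + 1) (by omega)) hx0 hx
  have h2 := tendsto_cfrac_of_three_term hlam
    (fun i : ℕ => le_div_of_weight hlam hpos hle (n := -((i : ℤ) + 1)) (by omega)) hy0 hy
  rw [tendsto_nhds_unique hF h1, tendsto_nhds_unique hG h2]
  have h := heq 0
  have hρ := hneg.ne
  have hw0' := hw0.ne
  norm_num at h ⊢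
  field_simp
  linarith

theorem isEigenseq_neg {w : ℤ → ℝ} (heq : IsEigenseq ρ lam w) :
    IsEigenseq ρ lam fun n => -w n := fun n => by
  linarith [heq n]

/-- The two-sided sequence equal to `x` on the right and to the alternating sequence
`(-1) ^ m * y m` on the left. -/
def glue (x y : ℕ → ℝ) (n : ℤ) : ℝ :=
  if 0 ≤ n then x n.natAbs else (-1) ^ n.natAbs * y n.natAbs

theorem glue_natCast (x y : ℕ → ℝ) (m : ℕ) : glue x y m = x m := by
  simp [glue]

theorem glue_neg_natCast {x y : ℕ → ℝ} (h0 : x 0 = y 0) (m : ℕ) :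
    glue x y (-m) = (-1) ^ m * y m := by
  rcases m with _ | m
  · simp [glue, h0]
  · rw [glue, if_neg (by omega), Int.natAbs_neg, Int.natAbs_natCast]

theorem glue_three_term {x y : ℕ → ℝ} (h0 : x 0 = y 0) {c : ℤ → ℝ}
    (hx : ∀ m : ℕ, x m - x (m + 2) = c ((m : ℤ) + 1) * x (m + 1))
    (hy : ∀ m : ℕ, y m - y (m + 2) = c (-((m : ℤ) + 1)) * y (m + 1))
    (hc : c 0 * x 0 + x 1 + y 1 = 0) (n : ℤ) :
    glue x y (n - 1) - glue x y (n + 1) = c n * glue x y n := by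
  have hr := glue_natCast x y
  have hl := glue_neg_natCast h0
  rcases lt_trichotomy n 0 with hn | rfl | hn
  · obtain ⟨m, rfl⟩ : ∃ m : ℕ, n = -((m : ℤ) + 1) := ⟨(-n - 1).toNat, by omega⟩
    have e1 := hl (m + 1)
    have e2 := hl (m + 2)
    push_cast at e1 e2
    rw [show -((m : ℤ) + 1) - 1 = -((m : ℤ) + 2) by ring,
      show -((m : ℤ) + 1) + 1 = -(m : ℤ) by ring, hl, e1, e2]
    linear_combination (-1) ^ (m + 1) * hy m
  · have e1 := hr 1
    have e2 := hl 1
    have e3 := hr 0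
    norm_num at e1 e2 e3 ⊢
    rw [e1, e2, e3]
    linarith
  · obtain ⟨m, rfl⟩ : ∃ m : ℕ, n = (m : ℤ) + 1 := ⟨(n - 1).toNat, by omega⟩
    have e1 := hr (m + 1)
    have e2 := hr (m + 2)
    push_cast at e1 e2
    rw [add_sub_cancel_right, show (m : ℤ) + 1 + 1 = m + 2 by ring, hr, e1, e2]
    exact hx m

theorem summable_sq_glue {x y : ℕ → ℝ} (h0 : x 0 = y 0) (hx : Summable fun m => x m ^ 2)
    (hy : Summable fun m => y m ^ 2) : Summable fun n => glue x y n ^ 2 := by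
  refine Summable.of_nat_of_neg ?_ ?_
  · simpa only [glue_natCast] using hx
  · refine hy.congr fun m => ?_
    rw [glue_neg_natCast h0, mul_pow, pow_right_comm, neg_one_sq, one_pow, one_mul]

theorem summable_sq_of_sub_eq {z w : ℤ → ℝ} (hlam : 0 < lam) (hz : Summable fun n => z n ^ 2)
    (h : ∀ n, z (n - 1) - z (n + 1) = lam * w n) : Summable fun n => w n ^ 2 := by
  have h1 : Summable fun n => z (n - 1) ^ 2 := hz.comp_injective (sub_left_injective (b := 1))
  have h2 : Summable fun n => z (n + 1) ^ 2 := hz.comp_injective (add_left_injective 1)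
  refine Summable.of_nonneg_of_le (fun _ => sq_nonneg _) (fun n => ?_)
    ((h1.add h2).mul_left (2 / lam ^ 2))
  have hw : w n = (z (n - 1) - z (n + 1)) / lam := by
    rw [h, mul_div_cancel_left₀ _ hlam.ne']
  rw [hw, div_pow, div_mul_eq_mul_div]
  gcongr
  nlinarith [sq_nonneg (z (n - 1) + z (n + 1))]

theorem exists_eigenseq_of_sum_eq_zero (hlam : 0 < lam) (hpos : ∀ n, n ≠ 0 → 0 < ρ n)
    (hneg : ρ 0 < 0) {x y : ℕ → ℝ} (hx1 : x 0 = 1) (hy1 : y 0 = 1)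
    (hx0 : ∀ m, 0 < x m) (hy0 : ∀ m, 0 < y m)
    (hx : ∀ m : ℕ, x m - x (m + 2) = lam / ρ ((m : ℤ) + 1) * x (m + 1))
    (hy : ∀ m : ℕ, y m - y (m + 2) = lam / ρ (-((m : ℤ) + 1)) * y (m + 1))
    (hxs : Summable fun m => x m ^ 2) (hys : Summable fun m => y m ^ 2)
    (hsum : lam / ρ 0 + x 1 + y 1 = 0) :
    ∃ w : ℤ → ℝ, Summable (fun n : ℤ => w n ^ 2) ∧ SignI0 w ∧ IsEigenseq ρ lam w := by
  have h0 : x 0 = y 0 := hx1.trans hy1.symm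
  have hρ : ∀ n, ρ n ≠ 0 := fun n => by
    rcases eq_or_ne n 0 with rfl | hn
    · exact hneg.ne
    · exact (hpos n hn).ne'
  have hz := glue_three_term h0 (c := fun n => lam / ρ n) hx hy (by simpa [hx1] using hsum)
  have hz' : ∀ n, glue x y (n - 1) - glue x y (n + 1) = lam * (glue x y n / ρ n) := fun n => by
    rw [hz]
    ring
  refine ⟨fun n => glue x y n / ρ n,
    summable_sq_of_sub_eq hlam (summable_sq_glue h0 hxs hys) hz', Or.inl ⟨?_, ?_, ?_, ?_⟩, ?_⟩
  · intro n hn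
    refine div_pos ?_ (hpos n (by omega))
    rw [glue, if_pos (by omega)]
    exact hx0 _
  · refine div_neg_of_pos_of_neg ?_ hneg
    simpa [glue] using hx0 0
  · refine div_neg_of_neg_of_pos ?_ (hpos _ (by omega))
    simpa [glue] using hy0 1
  · intro n hn
    beta_reduce
    rw [glue, if_neg (by omega), ← mul_div_assoc, ← mul_assoc, ← mul_pow]
    simpa using div_pos (hy0 n.natAbs) (hpos n (by omega))
  · intro n
    simp only [mul_div_cancel₀ _ (hρ _)]
    exact hz' n

theorem exists_limits_and_eigenseq_iff (hlam : 0 < lam) (hpos : ∀ n, n ≠ 0 → 0 < ρ n)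
    (hneg : ρ 0 < 0) (hle : ∀ n, ρ n ≤ 1) :
    ∃ F G : ℝ,
      Tendsto (fun k : ℕ => cfrac ((List.range k).map fun i : ℕ => lam / ρ ((i : ℤ) + 1)))
        atTop (𝓝 F) ∧
      Tendsto (fun k : ℕ => cfrac ((List.range k).map fun i : ℕ => lam / ρ (-((i : ℤ) + 1))))
        atTop (𝓝 G) ∧
      ((∃ w : ℤ → ℝ, Summable (fun n : ℤ => w n ^ 2) ∧ SignI0 w ∧ IsEigenseq ρ lam w) ↔
        lam / ρ 0 + F + G = 0) := by
  have ha : ∀ i : ℕ, lam ≤ lam / ρ ((i : ℤ) + 1) := fun i =>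
    le_div_of_weight hlam hpos hle (by omega)
  have hb : ∀ i : ℕ, lam ≤ lam / ρ (-((i : ℤ) + 1)) := fun i =>
    le_div_of_weight hlam hpos hle (by omega)
  obtain ⟨x, hx1, hx0, hx, hxs⟩ := exists_pos_three_term hlam ha
  obtain ⟨y, hy1, hy0, hy, hys⟩ := exists_pos_three_term hlam hb
  have hF := tendsto_cfrac_of_three_term hlam ha hx0 hx
  have hG := tendsto_cfrac_of_three_term hlam hb hy0 hy
  rw [hx1, div_one] at hF
  rw [hy1, div_one] at hG
  refine ⟨x 1, y 1, hF, hG, ?_, fun h => exists_eigenseq_of_sum_eq_zero hlam hpos hneg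
    hx1 hy1 hx0 hy0 hx hy hxs hys h⟩
  rintro ⟨w, -, hw | hw, heq⟩
  · exact sum_eq_zero_of_signI0aux hlam hpos hneg hle hw heq hF hG
  · exact sum_eq_zero_of_signI0aux hlam hpos hneg hle hw (isEigenseq_neg heq) hF hG

end Weights

theorem znorm_nonneg (v : ℤ × ℤ) : 0 ≤ znorm v := Real.sqrt_nonneg _

theorem sq_mul_one_add_lt_s3 (α : ℝ) {s t : ℝ} (hs : 0 ≤ s) (hst : s < t) :
    s ^ 2 * (1 + α ^ 2 * s ^ 2) < t ^ 2 * (1 + α ^ 2 * t ^ 2) := by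
  have h : s ^ 2 < t ^ 2 := pow_lt_pow_left₀ hst hs two_ne_zero
  have h2 : 1 + α ^ 2 * s ^ 2 ≤ 1 + α ^ 2 * t ^ 2 := by gcongr
  exact mul_lt_mul h h2 (by positivity) (sq_nonneg t)

theorem rho_le_one (p q : ℤ × ℤ) (α : ℝ) (n : ℤ) : rho p q α n ≤ 1 :=
  sub_le_self _ (by positivity)

theorem rho_pos {p q : ℤ × ℤ} (α : ℝ) {n : ℤ} (h : znorm p < znorm (q + n • p)) :
    0 < rho p q α n := by
  have h0 := (znorm_nonneg p).trans_lt h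
  rw [rho, sub_pos, div_lt_one (by positivity)]
  exact sq_mul_one_add_lt_s3 α (znorm_nonneg p) h

theorem rho_zero_neg {p q : ℤ × ℤ} (α : ℝ) (hq0 : q ≠ 0) (h : znorm q < znorm p) :
    rho p q α 0 < 0 := by
  have h0 := znorm_pos hq0
  rw [rho, zero_smul, add_zero, sub_neg, one_lt_div (by positivity)]
  exact sq_mul_one_add_lt_s3 α (znorm_nonneg q) h

/-- For `q` of type `I₀`: the continued fractions `f(λ)` and `g(λ)` converge, and
`λ > 0` is an eigenvalue of `L_{B,q}` with eigenvector of sign pattern `I₀` iff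
`λ/ρ₀ + f(λ) + g(λ) = 0`. -/
theorem eigenvalue_iff_continued_fraction_typeI0
    (p q : ℤ × ℤ) (hwedge : wedge q p ≠ 0) (α : ℝ) (hα : 0 ≤ α)
    (hq : znorm q < znorm p)
    (hn : ∀ n : ℤ, n ≠ 0 → znorm p < znorm (q + n • p)) :
    ∀ lam : ℝ, 0 < lam →
      ∃ flam glam : ℝ,
        Tendsto (fun k : ℕ =>
            cfrac ((List.range k).map fun i => lam / rho p q α ((i : ℤ) + 1)))
          atTop (nhds flam) ∧
        Tendsto (fun k : ℕ =>
            cfrac ((List.range k).map fun i => lam / rho p q α (-((i : ℤ) + 1))))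
          atTop (nhds glam) ∧
        ((∃ w : ℤ → ℝ, Summable (fun n : ℤ => (w n) ^ 2) ∧ SignI0 w ∧
            ∀ n : ℤ, rho p q α (n - 1) * w (n - 1) - rho p q α (n + 1) * w (n + 1)
              = lam * w n) ↔
          lam / rho p q α 0 + flam + glam = 0) := by
  intro lam hlam
  have hq0 : q ≠ 0 := by
    rintro rfl
    simp [wedge] at hwedge
  simp only [map_natCast_range]
  exact exists_limits_and_eigenseq_iff hlam (fun n hn0 => rho_pos α (hn n hn0))
    (rho_zero_neg α hq0 hq) (rho_le_one p q α)
end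

section
/- Let p, q ∈ ℤ² with q ∧ p ≠ 0, let α ≥ 0, and assume q is of type I₋ relative to p, i.e. ‖q‖ < ‖p‖, ‖q − p‖ = ‖p‖, and ‖q + n·p‖ > ‖p‖ for every integer n ∉ {0,−1}. Then for every λ > 0 the limit f(λ) = lim_{k→∞} [λ/ρ₁, λ/ρ₂, …, λ/ρ_k] exists, and a real number λ > 0 admits a square-summable sequence w : ℤ → ℝ satisfying ρ_{n−1} w_{n−1} − ρ_{n+1} w_{n+1} = λ w_n for all n ∈ ℤ together with the sign pattern I₋ if and only if λ/ρ₀ + f(λ) = 0. -/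
open Filter Topology

/-- Sign pattern `I₋` (one of the two branches): `w_n = 0` for `n < −1`, `w_{−1} < 0`,
`w₀ < 0`, and `w_n > 0` for `n > 0`. -/
def SignIminusAux (w : ℤ → ℝ) : Prop :=
  (∀ n : ℤ, n < -1 → w n = 0) ∧ w (-1) < 0 ∧ w 0 < 0 ∧ ∀ n : ℤ, 0 < n → 0 < w n

/-- A sequence satisfies the sign pattern `I₋` if either it or its negative satisfies
the conditions of `SignIminusAux`. -/
def SignIminus (w : ℤ → ℝ) : Prop := SignIminusAux w ∨ SignIminusAux (fun n => -w n)

theorem cfrac_map_range_succ (a : ℕ → ℝ) (k : ℕ) :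
    cfrac ((List.range (k + 1)).map a) =
      1 / (a 0 + cfrac ((List.range k).map fun i => a (i + 1))) := by
  simp [List.range_succ_eq_map, cfrac, Function.comp_def]

theorem cfrac_map_range_nonneg {a : ℕ → ℝ} (ha : ∀ i, 0 ≤ a i) (k : ℕ) :
    0 ≤ cfrac ((List.range k).map a) := by
  induction k generalizing a with
  | zero => simp [cfrac]
  | succ k ih =>
    rw [cfrac_map_range_succ]
    exact one_div_nonneg.2 (add_nonneg (ha 0) (ih fun i => ha (i + 1)))

theorem one_div_add_le {c A x : ℝ} (hc : 0 < c) (hA : c ≤ A) (hx : 0 ≤ x) :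
    1 / (A + x) ≤ 1 / c :=
  one_div_le_one_div_of_le hc (by linarith)

theorem cfrac_map_range_le {c : ℝ} (hc : 0 < c) {a : ℕ → ℝ} (ha : ∀ i, c ≤ a i) (k : ℕ) :
    cfrac ((List.range k).map a) ≤ 1 / c := by
  cases k with
  | zero => simp [cfrac, hc.le]
  | succ k =>
    rw [cfrac_map_range_succ]
    exact one_div_add_le hc (ha 0) (cfrac_map_range_nonneg (fun i => hc.le.trans (ha _)) k)

theorem abs_sub_le_of_mem_Icc {b x y : ℝ} (hx : 0 ≤ x) (hxb : x ≤ b) (hy : 0 ≤ y)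
    (hyb : y ≤ b) : |x - y| ≤ b := by
  rw [abs_le]
  constructor <;> linarith

/-- Two steps of a continued fraction with partial quotients at least `c` contract distances. -/
theorem abs_two_step_sub_le {c A B x y : ℝ} (hc : 0 < c) (hA : c ≤ A) (hB : c ≤ B)
    (hx : 0 ≤ x) (hy : 0 ≤ y) :
    |1 / (A + 1 / (B + x)) - 1 / (A + 1 / (B + y))| ≤ (1 + c ^ 2)⁻¹ * |x - y| := by
  have key : ∀ {t : ℝ}, 0 ≤ t → 1 + c ^ 2 ≤ A * (B + t) + 1 := fun {t} ht => by
    nlinarith [mul_le_mul hA (show c ≤ B + t by linarith) hc.le (hc.le.trans hA)]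
  have hX := key hx
  have hY := key hy
  have hc2 : 0 < c ^ 2 := by positivity
  have hBx : 0 < B + x := by linarith
  have hBy : 0 < B + y := by linarith
  have hA0 : 0 < A := by linarith
  have hprod : 1 + c ^ 2 ≤ (A * (B + x) + 1) * (A * (B + y) + 1) := by nlinarith
  have heq : 1 / (A + 1 / (B + x)) - 1 / (A + 1 / (B + y)) =
      ((A * (B + x) + 1) * (A * (B + y) + 1))⁻¹ * (x - y) := by
    have : 0 < A + 1 / (B + x) := by positivity
    have : 0 < A + 1 / (B + y) := by positivity
    have : 0 < A * (B + x) + 1 := by positivity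
    have : 0 < A * (B + y) + 1 := by positivity
    field_simp
    ring
  rw [heq, abs_mul, abs_of_nonneg (inv_nonneg.2 (by linarith))]
  gcongr

theorem abs_cfrac_map_range_sub_le {c : ℝ} (hc : 0 < c) (k : ℕ) {a : ℕ → ℝ}
    (ha : ∀ i, c ≤ a i) (m n : ℕ) :
    |cfrac ((List.range (m + 2 * k)).map a) - cfrac ((List.range (n + 2 * k)).map a)| ≤
      ((1 + c ^ 2)⁻¹) ^ k * (1 / c) := by
  have h0 : ∀ {b : ℕ → ℝ}, (∀ i, c ≤ b i) → ∀ j, 0 ≤ cfrac ((List.range j).map b) :=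
    fun hb => cfrac_map_range_nonneg fun i => hc.le.trans (hb i)
  induction k generalizing a with
  | zero =>
    rw [pow_zero, one_mul]
    exact abs_sub_le_of_mem_Icc (h0 ha _) (cfrac_map_range_le hc ha _) (h0 ha _)
      (cfrac_map_range_le hc ha _)
  | succ k ih =>
    have ha2 : ∀ i, c ≤ a (i + 1 + 1) := fun i => ha _
    rw [show m + 2 * (k + 1) = m + 2 * k + 1 + 1 by ring,
      show n + 2 * (k + 1) = n + 2 * k + 1 + 1 by ring]
    simp only [cfrac_map_range_succ]
    refine (abs_two_step_sub_le hc (ha 0) (ha _) (h0 ha2 _) (h0 ha2 _)).trans ?_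
    rw [pow_succ' _ k, mul_assoc]
    gcongr
    exact ih ha2

theorem tendsto_contraction_pow {c : ℝ} (hc : 0 < c) :
    Tendsto (fun k : ℕ => ((1 + c ^ 2)⁻¹) ^ k * (1 / c)) atTop (𝓝 0) := by
  have hc2 : 0 < c ^ 2 := by positivity
  simpa using (tendsto_pow_atTop_nhds_zero_of_lt_one (r := (1 + c ^ 2)⁻¹) (by positivity)
    (inv_lt_one_of_one_lt₀ (by linarith))).mul_const (1 / c)

/-- A continued fraction whose partial quotients are bounded below by a positive constant
converges. -/
theorem exists_tendsto_cfrac_map_range {c : ℝ} (hc : 0 < c) {a : ℕ → ℝ} (ha : ∀ i, c ≤ a i) :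
    ∃ L, Tendsto (fun k => cfrac ((List.range k).map a)) atTop (𝓝 L) := by
  apply cauchySeq_tendsto_of_complete
  rw [Metric.cauchySeq_iff]
  intro ε hε
  obtain ⟨k, hk⟩ := ((tendsto_contraction_pow hc).eventually_lt_const hε).exists
  refine ⟨2 * k, fun m hm n hn => ?_⟩
  obtain ⟨m, rfl⟩ := Nat.exists_eq_add_of_le' hm
  obtain ⟨n, rfl⟩ := Nat.exists_eq_add_of_le' hn
  exact (abs_cfrac_map_range_sub_le hc k ha m n).trans_lt hk

/-- The tails of a convergent continued fraction satisfy the complete-quotient recurrence. -/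
theorem exists_cfrac_tails {c : ℝ} (hc : 0 < c) {a : ℕ → ℝ} (ha : ∀ i, c ≤ a i) :
    ∃ r : ℕ → ℝ, Tendsto (fun k => cfrac ((List.range k).map a)) atTop (𝓝 (r 0)) ∧
      (∀ n, 0 < r n) ∧ ∀ n, r n = 1 / (a n + r (n + 1)) := by
  have hlim : ∀ n, ∃ L, Tendsto (fun k => cfrac ((List.range k).map fun i => a (i + n)))
      atTop (𝓝 L) := fun n => exists_tendsto_cfrac_map_range hc fun i => ha _
  choose r hr using hlim
  have hr0 : ∀ n, 0 ≤ r n := fun n => ge_of_tendsto' (hr n) fun k =>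
    cfrac_map_range_nonneg (fun i => hc.le.trans (ha _)) k
  have hpos : ∀ n, 0 < a n + r (n + 1) := fun n =>
    add_pos_of_pos_of_nonneg (hc.trans_le (ha n)) (hr0 _)
  have hrec : ∀ n, r n = 1 / (a n + r (n + 1)) := by
    intro n
    refine tendsto_nhds_unique ((tendsto_add_atTop_iff_nat 1).2 (hr n)) ?_
    simp only [cfrac_map_range_succ, zero_add, add_right_comm _ 1 n]
    exact tendsto_const_nhds.div (tendsto_const_nhds.add (hr (n + 1))) (hpos n).ne'
  refine ⟨r, hr 0, fun n => ?_, hrec⟩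
  rw [hrec]
  exact one_div_pos.2 (hpos n)

theorem abs_sub_le_of_quotient_recurrence {c : ℝ} (hc : 0 < c) {a : ℕ → ℝ}
    (ha : ∀ i, c ≤ a i) {r s : ℕ → ℝ} (hr : ∀ n, 0 < r n) (hs : ∀ n, 0 < s n)
    (hr' : ∀ n, r n = 1 / (a n + r (n + 1))) (hs' : ∀ n, s n = 1 / (a n + s (n + 1)))
    (k n : ℕ) : |r n - s n| ≤ ((1 + c ^ 2)⁻¹) ^ k * (1 / c) := by
  induction k generalizing n with
  | zero =>
    rw [pow_zero, one_mul]
    refine abs_sub_le_of_mem_Icc (hr n).le ?_ (hs n).le ?_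
    · rw [hr']; exact one_div_add_le hc (ha n) (hr _).le
    · rw [hs']; exact one_div_add_le hc (ha n) (hs _).le
  | succ k ih =>
    rw [hr' n, hs' n, hr' (n + 1), hs' (n + 1), pow_succ' _ k, mul_assoc]
    refine (abs_two_step_sub_le hc (ha n) (ha _) (hr _).le (hs _).le).trans ?_
    gcongr
    exact ih _

/-- Positive solutions of the complete-quotient recurrence are unique. -/
theorem eq_of_quotient_recurrence {c : ℝ} (hc : 0 < c) {a : ℕ → ℝ}
    (ha : ∀ i, c ≤ a i) {r s : ℕ → ℝ} (hr : ∀ n, 0 < r n) (hs : ∀ n, 0 < s n)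
    (hr' : ∀ n, r n = 1 / (a n + r (n + 1))) (hs' : ∀ n, s n = 1 / (a n + s (n + 1)))
    (n : ℕ) : r n = s n := by
  have h := ge_of_tendsto' (tendsto_contraction_pow hc) fun k =>
    abs_sub_le_of_quotient_recurrence hc ha hr hs hr' hs' k n
  exact sub_eq_zero.1 (abs_nonpos_iff.1 h)

/-- An eigenvector with sign pattern `I₋` determines the value of the continued fraction. -/
theorem SignIminusAux.div_add_eq_zero {ρ w : ℤ → ℝ} {lam : ℝ} (hlam : 0 < lam)
    (hm : ρ (-1) = 0) (h0 : ρ 0 < 0) (hpos : ∀ n : ℤ, 0 < n → 0 < ρ n)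
    (hle : ∀ n : ℤ, 0 < n → ρ n ≤ 1) (hw : SignIminusAux w)
    (hrec : ∀ n : ℤ, ρ (n - 1) * w (n - 1) - ρ (n + 1) * w (n + 1) = lam * w n)
    {r : ℕ → ℝ} (hr : ∀ n, 0 < r n)
    (hr' : ∀ n : ℕ, r n = 1 / (lam / ρ ((n : ℤ) + 1) + r (n + 1))) :
    lam / ρ 0 + r 0 = 0 := by
  obtain ⟨-, -, hw0, hwpos⟩ := hw
  have hz : ∀ n : ℕ, 0 < ρ n * w n := by
    intro n
    rcases n.eq_zero_or_pos with rfl | hn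
    · simpa using mul_pos_of_neg_of_neg h0 hw0
    · exact mul_pos (hpos _ (by exact_mod_cast hn)) (hwpos _ (by exact_mod_cast hn))
  have ha : ∀ n : ℕ, lam ≤ lam / ρ ((n : ℤ) + 1) := fun n =>
    le_div_self hlam.le (hpos _ (by positivity)) (hle _ (by positivity))
  let s : ℕ → ℝ := fun n => ρ ((n + 1 : ℕ) : ℤ) * w ((n + 1 : ℕ) : ℤ) / (ρ n * w n)
  have hs : ∀ n, 0 < s n := fun n => div_pos (hz _) (hz _)
  have hs' : ∀ n : ℕ, s n = 1 / (lam / ρ ((n : ℤ) + 1) + s (n + 1)) := by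
    intro n
    have e := hrec ((n : ℤ) + 1)
    have p0 := hz n
    have p1 := hz (n + 1)
    have p2 := hpos ((n : ℤ) + 1) (by positivity)
    have p3 := hwpos ((n : ℤ) + 1) (by positivity)
    have p4 := hs (n + 1)
    simp only [s] at p4 ⊢
    push_cast at p1 p4 ⊢
    rw [add_sub_cancel_right] at e
    rw [eq_div_iff (by positivity), div_mul_eq_mul_div, div_eq_one_iff_eq p0.ne']
    field_simp
    linarith
  rw [eq_of_quotient_recurrence hlam ha hr hs hr' hs' 0]
  have e := hrec 0
  simp only [zero_sub, zero_add, hm, zero_mul] at e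
  have h0' := h0.ne
  have hw0' := hw0.ne
  simp only [s, zero_add, Nat.cast_one, Nat.cast_zero]
  field_simp
  linarith

theorem summable_sq_of_nonneg {u : ℕ → ℝ} (hu : ∀ n, 0 ≤ u n) (h : Summable u) :
    Summable fun n => u n ^ 2 := by
  refine h.of_norm_bounded_eventually_nat ?_
  filter_upwards [h.tendsto_atTop_zero.eventually_le_const one_pos] with n hn
  rw [Real.norm_of_nonneg (sq_nonneg _)]
  nlinarith [hu n]

/-- A positive solution of the complete-quotient recurrence with the right initial value
yields a square-summable eigenvector with sign pattern `I₋`. -/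
theorem exists_signIminusAux_eigenvector {ρ : ℤ → ℝ} {lam : ℝ} (hlam : 0 < lam)
    (hm : ρ (-1) = 0) (h0 : ρ 0 < 0) (hpos : ∀ n : ℤ, 0 < n → 0 < ρ n)
    {r : ℕ → ℝ} (hr : ∀ n, 0 < r n)
    (hr' : ∀ n : ℕ, r n = 1 / (lam / ρ ((n : ℤ) + 1) + r (n + 1)))
    (heq : lam / ρ 0 + r 0 = 0) :
    ∃ w : ℤ → ℝ, Summable (fun n : ℤ => (w n) ^ 2) ∧ SignIminusAux w ∧
      ∀ n : ℤ, ρ (n - 1) * w (n - 1) - ρ (n + 1) * w (n + 1) = lam * w n := by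
  let z : ℕ → ℝ := fun n => ∏ i ∈ Finset.range n, r i
  have hz : ∀ n, 0 < z n := fun n => Finset.prod_pos fun i _ => hr i
  have hz1 : ∀ n, z (n + 1) = z n * r n := fun n => Finset.prod_range_succ _ _
  have hzrec : ∀ n : ℕ, z n - z (n + 2) = lam * (z (n + 1) / ρ ((n : ℤ) + 1)) := by
    intro n
    have p := hpos ((n : ℤ) + 1) (by positivity)
    have p1 := hr (n + 1)
    have e : r n * (lam / ρ ((n : ℤ) + 1) + r (n + 1)) = 1 := by
      rw [hr' n]
      exact one_div_mul_cancel (by positivity)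
    rw [hz1 (n + 1), hz1 n]
    linear_combination (-z n) * e
  let w : ℤ → ℝ := fun n =>
    if n < -1 then 0 else if n = -1 then -1 / lam else z n.toNat / ρ n
  have hw_neg : ∀ n : ℤ, n < -1 → w n = 0 := fun n h => if_pos h
  have hw_m : w (-1) = -1 / lam := by simp [w]
  have hw_nat : ∀ n : ℕ, w n = z n / ρ n := by
    intro n
    simp only [w]
    rw [if_neg (by omega), if_neg (by omega), Int.toNat_natCast]
  have hw_zero : w 0 = 1 / ρ 0 := by simpa [z] using hw_nat 0
  have hρ : ∀ n : ℕ, ρ n ≠ 0 := by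
    intro n
    rcases n.eq_zero_or_pos with rfl | hn
    · exact_mod_cast h0.ne
    · exact (hpos _ (by exact_mod_cast hn)).ne'
  have hρw : ∀ n : ℕ, ρ n * w n = z n := fun n => by
    rw [hw_nat, mul_div_cancel₀ _ (hρ n)]
  have hw_pos : ∀ n : ℕ, 0 < w ((n + 1 : ℕ) : ℤ) := fun n => by
    rw [hw_nat]
    exact div_pos (hz _) (hpos _ (by positivity))
  have hw_rec : ∀ n : ℕ, z n - z (n + 2) = lam * w ((n + 1 : ℕ) : ℤ) := fun n => by
    rw [hw_nat, hzrec]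
    push_cast
    rfl
  have hsum : Summable fun n : ℕ => w ((n + 1 : ℕ) : ℤ) := by
    refine summable_of_sum_range_le (c := (z 0 + z 1) / lam) (fun n => (hw_pos n).le) fun n => ?_
    rw [le_div_iff₀' hlam]
    have : lam * ∑ i ∈ Finset.range n, w ((i + 1 : ℕ) : ℤ) =
        z 0 + z 1 - z n - z (n + 1) := by
      induction n with
      | zero => simp
      | succ n ih =>
        rw [Finset.sum_range_succ, mul_add, ih, ← hw_rec]
        ring
    linarith [hz n, hz (n + 1)]
  refine ⟨w, Summable.of_nat_of_neg_add_one ?_ ?_, ⟨hw_neg, ?_, ?_, ?_⟩, ?_⟩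
  · exact (summable_nat_add_iff 1).1 (summable_sq_of_nonneg (fun n => (hw_pos n).le) hsum)
  · refine summable_of_ne_finset_zero (s := {0}) fun n hn => ?_
    rw [hw_neg _ (by simp at hn; omega), zero_pow two_ne_zero]
  · rw [hw_m]
    exact div_neg_of_neg_of_pos (by norm_num) hlam
  · rw [hw_zero]
    exact one_div_neg.2 h0
  · intro n hn
    obtain ⟨k, rfl⟩ : ∃ k : ℕ, n = ((k + 1 : ℕ) : ℤ) := ⟨(n - 1).toNat, by omega⟩
    exact hw_pos k
  · intro n
    rcases lt_trichotomy n (-1) with h | rfl | h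
    · rw [hw_neg n h, hw_neg (n - 1) (by omega)]
      rcases eq_or_ne n (-2) with rfl | h2
      · norm_num [hm]
      · rw [hw_neg (n + 1) (by omega)]
        ring
    · rw [hw_neg (-1 - 1) (by norm_num), hw_m, neg_add_cancel, hw_zero]
      have := h0.ne
      field_simp
      ring
    · obtain ⟨k, rfl⟩ : ∃ k : ℕ, n = k := ⟨n.toNat, by omega⟩
      cases k with
      | zero =>
        have e := hρw 1
        have e1 := hz1 0
        simp only [z, Finset.range_zero, Finset.prod_empty, zero_add, one_mul] at e1
        rw [Nat.cast_one] at e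
        simp only [Nat.cast_zero, zero_sub, zero_add, hm, zero_mul, hw_zero, e]
        simp only [z, e1]
        linear_combination -heq
      | succ k =>
        rw [← hw_rec, ← hρw k, ← hρw (k + 2)]
        push_cast
        ring_nf

theorem energy_strictMono (α : ℝ) {x y : ℝ} (hx : 0 ≤ x) (hxy : x < y) :
    x ^ 2 * (1 + α ^ 2 * x ^ 2) < y ^ 2 * (1 + α ^ 2 * y ^ 2) := by
  have h : x ^ 2 < y ^ 2 := by gcongr
  have h' : α ^ 2 * x ^ 2 ≤ α ^ 2 * y ^ 2 := by gcongr
  exact mul_lt_mul h (by linarith) (by positivity) (sq_nonneg y)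

/-- For `q` of type `I₋`: the continued fraction `f(λ)` converges, and `λ > 0` is an
eigenvalue of `L_{B,q}` with eigenvector of sign pattern `I₋` iff `λ/ρ₀ + f(λ) = 0`. -/
theorem eigenvalue_iff_continued_fraction_typeIminus
    (p q : ℤ × ℤ) (hwedge : wedge q p ≠ 0) (α : ℝ) (hα : 0 ≤ α)
    (hq : znorm q < znorm p)
    (hqp : znorm (q - p) = znorm p)
    (hn : ∀ n : ℤ, n ≠ 0 → n ≠ -1 → znorm p < znorm (q + n • p)) :
    ∀ lam : ℝ, 0 < lam →
      ∃ flam : ℝ,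
        Tendsto (fun k : ℕ =>
            cfrac ((List.range k).map fun i => lam / rho p q α ((i : ℤ) + 1)))
          atTop (nhds flam) ∧
        ((∃ w : ℤ → ℝ, Summable (fun n : ℤ => (w n) ^ 2) ∧ SignIminus w ∧
            ∀ n : ℤ, rho p q α (n - 1) * w (n - 1) - rho p q α (n + 1) * w (n + 1)
              = lam * w n) ↔
          lam / rho p q α 0 + flam = 0) := by
  intro lam hlam
  have hp : 0 < znorm p := (znorm_nonneg q).trans_lt hq
  have hq0 : 0 < znorm q := znorm_pos fun h => hwedge (by simp [h, wedge])
  have hm : rho p q α (-1) = 0 := by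
    have h : q + (-1 : ℤ) • p = q - p := by rw [neg_one_smul, sub_eq_add_neg]
    rw [rho, h, hqp, div_self (by positivity), sub_self]
  have h0 : rho p q α 0 < 0 := by
    rw [rho, zero_smul, add_zero, sub_neg, one_lt_div (by positivity)]
    exact energy_strictMono α hq0.le hq
  have hpos : ∀ n : ℤ, 0 < n → 0 < rho p q α n := by
    intro n h
    have hlt := hn n (by omega) (by omega)
    have := hp.trans hlt
    rw [rho, sub_pos, div_lt_one (by positivity)]
    exact energy_strictMono α hp.le hlt
  have hle : ∀ n : ℤ, 0 < n → rho p q α n ≤ 1 := fun n _ =>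
    sub_le_self _ (by positivity)
  have ha : ∀ i : ℕ, lam ≤ lam / rho p q α ((i : ℤ) + 1) := fun i =>
    le_div_self hlam.le (hpos _ (by positivity)) (hle _ (by positivity))
  obtain ⟨r, hlim, hr, hr'⟩ := exists_cfrac_tails hlam ha
  refine ⟨r 0, ?_, ?_, fun heq => ?_⟩
  · simpa only [List.bind_eq_flatMap, List.pure_def, ← List.map_eq_flatMap, List.map_map,
      Function.comp_def] using hlim
  · rintro ⟨w, -, hw | hw, hrec⟩
    · exact hw.div_add_eq_zero hlam hm h0 hpos hle hrec hr hr'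
    · exact hw.div_add_eq_zero hlam hm h0 hpos hle
        (fun n => by linear_combination -hrec n) hr hr'
  · obtain ⟨w, hsum, hw, hrec⟩ := exists_signIminusAux_eigenvector hlam hm h0 hpos hr hr' heq
    exact ⟨w, hsum, Or.inl hw, hrec⟩
end

section
/- Let ρ : ℤ → ℝ be a bounded real sequence. Suppose λ ∈ ℂ and w : ℤ → ℂ is a square-summable sequence, not identically zero, satisfying ρ_{n−1} w_{n−1} − ρ_{n+1} w_{n+1} = λ w_n for all n ∈ ℤ. Then each of −λ, the complex conjugate of λ, and minus the complex conjugate of λ also admits a square-summable, not identically zero, solution of the same recurrence. (The eigenvalues of L_{B,q} are symmetric about both coordinate axes.) -/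
open Filter Topology

/-- `v` is a nonzero square-summable solution of
`ρ_{n−1} v_{n−1} − ρ_{n+1} v_{n+1} = μ v_n`. -/
def IsEigenvector (ρ : ℤ → ℝ) (μ : ℂ) (v : ℤ → ℂ) : Prop :=
  Summable (fun n : ℤ => ‖v n‖ ^ 2) ∧ v ≠ 0 ∧
    ∀ n : ℤ, (ρ (n - 1) : ℂ) * v (n - 1) - (ρ (n + 1) : ℂ) * v (n + 1) = μ * v n

theorem IsEigenvector.alternate {ρ : ℤ → ℝ} {μ : ℂ} {v : ℤ → ℂ} (h : IsEigenvector ρ μ v) :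
    IsEigenvector ρ (-μ) (fun n => (-1) ^ n * v n) := by
  obtain ⟨hsum, hv, hrec⟩ := h
  refine ⟨by simpa using hsum, fun h0 => hv ?_, fun n => ?_⟩
  · funext n
    exact (mul_eq_zero.mp (congrFun h0 n)).resolve_left (zpow_ne_zero n (by norm_num))
  · have hneg : (-1 : ℂ) ≠ 0 := by norm_num
    simp only [zpow_sub_one₀ hneg, zpow_add_one₀ hneg, inv_neg_one]
    linear_combination (-(-1 : ℂ) ^ n) * hrec n

theorem IsEigenvector.conj {ρ : ℤ → ℝ} {μ : ℂ} {v : ℤ → ℂ} (h : IsEigenvector ρ μ v) :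
    IsEigenvector ρ (starRingEnd ℂ μ) (fun n => starRingEnd ℂ (v n)) := by
  obtain ⟨hsum, hv, hrec⟩ := h
  refine ⟨by simpa using hsum, fun h0 => hv ?_, fun n => ?_⟩
  · funext n
    simpa using congrFun h0 n
  · simpa using congrArg (starRingEnd ℂ) (hrec n)

/-- The nonzero eigenvalues of `L_{B,q}` are symmetric about both coordinate axes:
if `λ` admits a nonzero square-summable solution of the recurrence
`ρ_{n−1} w_{n−1} − ρ_{n+1} w_{n+1} = λ w_n`, then so do `−λ`, `conj λ`, `−conj λ`. -/
theorem eigenvalues_symmetric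
    (ρ : ℤ → ℝ) (hbd : ∃ M : ℝ, ∀ n : ℤ, |ρ n| ≤ M)
    (lam : ℂ) (w : ℤ → ℂ)
    (hsum : Summable (fun n : ℤ => ‖w n‖ ^ 2)) (hw : w ≠ 0)
    (hrec : ∀ n : ℤ, (ρ (n - 1) : ℂ) * w (n - 1) - (ρ (n + 1) : ℂ) * w (n + 1)
      = lam * w n) :
    ∀ μ ∈ ({-lam, starRingEnd ℂ lam, -(starRingEnd ℂ lam)} : Set ℂ),
      ∃ v : ℤ → ℂ, Summable (fun n : ℤ => ‖v n‖ ^ 2) ∧ v ≠ 0 ∧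
        ∀ n : ℤ, (ρ (n - 1) : ℂ) * v (n - 1) - (ρ (n + 1) : ℂ) * v (n + 1)
          = μ * v n := by
  have h : IsEigenvector ρ lam w := ⟨hsum, hw, hrec⟩
  rintro μ (rfl | rfl | rfl)
  · exact ⟨_, h.alternate⟩
  · exact ⟨_, h.conj⟩
  · exact ⟨_, h.conj.alternate⟩
end

section
/- Let ρ : ℤ → ℝ be a bounded real sequence with ρ_n ≥ 0 for all n ∈ ℤ. If λ ∈ ℂ and w : ℤ → ℂ is a square-summable sequence, not identically zero, satisfying ρ_{n−1} w_{n−1} − ρ_{n+1} w_{n+1} = λ w_n for all n ∈ ℤ, then Re λ = 0. (If q is a point of type 0, i.e. all coefficients ρ_n are nonnegative, the operator L_{B,q} has no unstable point spectrum.) -/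
open Filter Topology

/-- The real inner product of two complex numbers is bounded by the sum of squared norms. -/
lemma abs_re_mul_re_add_im_mul_im_le (x y : ℂ) :
    ‖x.re * y.re + x.im * y.im‖ ≤ ‖x‖ ^ 2 + ‖y‖ ^ 2 := by
  rw [Complex.sq_norm, Complex.sq_norm, Complex.normSq_apply, Complex.normSq_apply,
    Real.norm_eq_abs, abs_le]
  constructor
  · linarith [sq_nonneg (x.re + y.re), sq_nonneg (x.im + y.im), mul_self_nonneg x.re,
      mul_self_nonneg x.im, mul_self_nonneg y.re, mul_self_nonneg y.im]
  · linarith [sq_nonneg (x.re - y.re), sq_nonneg (x.im - y.im), mul_self_nonneg x.re,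
      mul_self_nonneg x.im, mul_self_nonneg y.re, mul_self_nonneg y.im]

/-- Unconditional sums over `ℤ` are invariant under translation. -/
lemma hasSum_sub_right {f : ℤ → ℝ} {s : ℝ} (hf : HasSum f s) (k : ℤ) :
    HasSum (fun n => f (n - k)) s := by
  have h := (Equiv.hasSum_iff (Equiv.subRight k)).mpr hf
  simpa only [Function.comp_def, Equiv.subRight_apply] using h

/-- If all coefficients `ρ_n` are nonnegative (`q` is a point of type 0), the operator
`L_{B,q}` has no unstable point spectrum: every eigenvalue is purely imaginary. -/
theorem no_unstable_spectrum_type0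
    (ρ : ℤ → ℝ) (hbd : ∃ M : ℝ, ∀ n : ℤ, |ρ n| ≤ M)
    (hpos : ∀ n : ℤ, 0 ≤ ρ n)
    (lam : ℂ) (w : ℤ → ℂ)
    (hsum : Summable (fun n : ℤ => ‖w n‖ ^ 2)) (hw : w ≠ 0)
    (hrec : ∀ n : ℤ, (ρ (n - 1) : ℂ) * w (n - 1) - (ρ (n + 1) : ℂ) * w (n + 1)
      = lam * w n) :
    lam.re = 0 := by
  obtain ⟨M, hM⟩ := hbd
  by_contra hlam
  set a : ℤ → ℂ := fun n => (ρ n : ℂ) * w n with ha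
  have ha_sq : Summable fun n => ‖a n‖ ^ 2 := by
    refine Summable.of_nonneg_of_le (fun n => by positivity) (fun n => ?_)
      (hsum.mul_left (M ^ 2))
    have h : ‖a n‖ ^ 2 = |ρ n| ^ 2 * ‖w n‖ ^ 2 := by simp [ha, mul_pow]
    rw [h]
    gcongr
    exact hM n
  set c : ℤ → ℝ := fun n => (a n).re * (a (n + 1)).re + (a n).im * (a (n + 1)).im with hc
  have hc_sum : Summable c := by
    have h1 : Summable fun n => ‖a (n + 1)‖ ^ 2 :=
      ha_sq.comp_injective (i := fun n : ℤ => n + 1) (add_left_injective 1)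
    refine Summable.of_norm_bounded (ha_sq.add h1) (fun n => ?_)
    exact abs_re_mul_re_add_im_mul_im_le _ _
  have hc_shift : HasSum (fun n => c (n - 1)) (∑' n, c n) :=
    hasSum_sub_right hc_sum.hasSum 1
  have henergy : ∀ n, c (n - 1) - c n = lam.re * (ρ n * ‖w n‖ ^ 2) := by
    intro n
    have hre := congrArg Complex.re (hrec n)
    have him := congrArg Complex.im (hrec n)
    rw [Complex.sq_norm, Complex.normSq_apply]
    simp only [hc, ha, sub_add_cancel]
    simp only [Complex.sub_re, Complex.sub_im, Complex.mul_re, Complex.mul_im,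
      Complex.ofReal_re, Complex.ofReal_im, zero_mul, sub_zero, add_zero] at hre him ⊢
    linear_combination ρ n * (w n).re * hre + ρ n * (w n).im * him
  have hzero : HasSum (fun n => ρ n * ‖w n‖ ^ 2) 0 := by
    have h := (hc_shift.sub hc_sum.hasSum).mul_left lam.re⁻¹
    simpa [henergy, inv_mul_cancel_left₀ hlam] using h
  have hterm := (hasSum_zero_iff_of_nonneg
    (fun n => mul_nonneg (hpos n) (sq_nonneg ‖w n‖))).mp hzero
  have ha_zero : ∀ n, (ρ n : ℂ) * w n = 0 := by
    intro n
    have h := congrFun hterm n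
    simpa using h
  refine hw (funext fun n => ?_)
  have h := hrec n
  rw [ha_zero, ha_zero, sub_zero, eq_comm, mul_eq_zero] at h
  refine h.resolve_left fun h0 => hlam ?_
  simp [h0]
end

section
/- Let a, b > 0. The truncated periodic continued fractions F^{(k)}(a,b) (with entries alternating a, b, …, starting with a and having k entries) converge as k → ∞ to F(a,b) = (b/a) / ( √((b/2)² + b/a) + b/2 ). -/
open Filter Topology

/-- Continued fractions with nonnegative entries are nonnegative. -/
lemma cfrac_nonneg : ∀ l : List ℝ, (∀ x ∈ l, 0 ≤ x) → 0 ≤ cfrac l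
  | [], _ => le_rfl
  | a :: l, h => by
    have ha : 0 ≤ a := h a (by simp)
    have hl : 0 ≤ cfrac l := cfrac_nonneg l fun x hx => h x (by simp [hx])
    rw [cfrac]
    positivity

/-- Adding one period to the truncated continued fraction. -/
lemma cfrac_alternating_add_two (a b : ℝ) (k : ℕ) :
    cfrac ((List.range (k + 2)).map fun i => if i % 2 = 0 then a else b) =
      1 / (a + 1 / (b + cfrac ((List.range k).map fun i => if i % 2 = 0 then a else b))) := by
  simp only [List.range_succ_eq_map, List.map_cons, List.map_map, cfrac]
  simp [Function.comp_def, Nat.add_assoc]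

/-- One period of the continued fraction contracts distances to its fixed point. -/
lemma abs_period_sub_le {a b x F : ℝ} (ha : 0 < a) (hb : 0 < b) (hx : 0 ≤ x) (hF : 0 ≤ F)
    (hfix : a * F ^ 2 + a * b * F = b) :
    |1 / (a + 1 / (b + x)) - F| ≤ (1 + a * b)⁻¹ * |x - F| := by
  have hab : 0 < a * b := mul_pos ha hb
  have hax : 0 ≤ a * x := by positivity
  have haF : 0 ≤ a * F := by positivity
  have key : 1 / (a + 1 / (b + x)) - F =
      ((1 + a * b + a * x) * (1 + a * b + a * F))⁻¹ * (x - F) := by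
    have h₁ : b + x ≠ 0 := by positivity
    have h₂ : 1 + a * b + a * x ≠ 0 := by positivity
    have h₃ : 1 + a * b + a * F ≠ 0 := by positivity
    have hperiod : 1 / (a + 1 / (b + x)) = (b + x) / (1 + a * b + a * x) := by
      have : a + 1 / (b + x) = (1 + a * b + a * x) / (b + x) := by
        field_simp
        ring
      rw [this, one_div_div]
    rw [hperiod]
    field_simp
    linear_combination (-(1 + a * b + a * x)) * hfix
  rw [key, abs_mul, abs_of_nonneg (by positivity)]
  gcongr
  nlinarith [mul_nonneg hax haF, mul_nonneg hab.le haF]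

/-- The truncations of the periodic continued fraction `[a, b, a, b, …]` converge to
`F(a,b) = (b/a) / (√((b/2)² + b/a) + b/2)`. -/
theorem periodic_continued_fraction_value (a b : ℝ) (ha : 0 < a) (hb : 0 < b) :
    Tendsto (fun k : ℕ =>
        cfrac ((List.range k).map fun i => if i % 2 = 0 then a else b))
      atTop
      (nhds ((b / a) / (Real.sqrt ((b / 2) ^ 2 + b / a) + b / 2))) := by
  set G : ℕ → ℝ := fun k => cfrac ((List.range k).map fun i => if i % 2 = 0 then a else b) with hG
  set F : ℝ := (b / a) / (Real.sqrt ((b / 2) ^ 2 + b / a) + b / 2) with hF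
  have hF0 : 0 ≤ F := by positivity
  have hfix : a * F ^ 2 + a * b * F = b := by
    have hs : Real.sqrt ((b / 2) ^ 2 + b / a) ^ 2 = (b / 2) ^ 2 + b / a :=
      Real.sq_sqrt (by positivity)
    have hFs : F = Real.sqrt ((b / 2) ^ 2 + b / a) - b / 2 := by
      rw [hF, div_eq_iff (by positivity)]
      linear_combination -hs
    have hba : a * (b / a) = b := by field_simp
    rw [hFs]
    linear_combination a * hs + hba
  have hG0 (k : ℕ) : 0 ≤ G k := by
    refine cfrac_nonneg _ fun x hx => ?_
    obtain ⟨i, -, rfl⟩ := List.mem_map.1 hx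
    split_ifs <;> positivity
  have hstep (k : ℕ) : |G (k + 2) - F| ≤ (1 + a * b)⁻¹ * |G k - F| := by
    simp only [hG, cfrac_alternating_add_two]
    exact abs_period_sub_le ha hb (hG0 k) hF0 hfix
  have hbound (k : ℕ) :
      |G k - F| ≤ (1 + a * b)⁻¹ ^ (k / 2) * max |G 0 - F| |G 1 - F| := by
    induction k using Nat.twoStepInduction with
    | zero => simp
    | one => simp
    | more k ih _ =>
      rw [Nat.add_div_right k two_pos, pow_succ', mul_assoc]
      exact (hstep k).trans (by gcongr)
  have hr : (1 + a * b)⁻¹ < 1 := inv_lt_one_of_one_lt₀ (by linarith [mul_pos ha hb])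
  have hpow : Tendsto (fun k : ℕ => (1 + a * b)⁻¹ ^ (k / 2)) atTop (𝓝 0) :=
    (tendsto_pow_atTop_nhds_zero_of_lt_one (by positivity) hr).comp
      (Nat.tendsto_div_const_atTop two_ne_zero)
  rw [tendsto_iff_dist_tendsto_zero]
  refine squeeze_zero (fun _ => dist_nonneg) hbound ?_
  simpa using hpow.mul_const (max |G 0 - F| |G 1 - F|)
end

section
/- Let (c_k)_{k≥1} be a sequence of reals with 0 < A ≤ c_k ≤ B for all k, let x > 0, and suppose the truncated continued fractions G^{(k)}(x) = [x·c₁, x·c₂, …, x·c_k] converge as k → ∞ to a limit G(x). Then (A/B) / ( √((xA/2)² + A/B) + xA/2 ) ≤ G(x) ≤ (B/A) / ( √((xB/2)² + B/A) + xB/2 ). -/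
open Filter Topology

/-- One step `y ↦ 1 / (t + y)` with `t ∈ [a, b]` shrinks by the factor `L * U` the relative
distance `ε` to the interval `[L, U]` whose endpoints satisfy `U = 1 / (a + L)`,
`L = 1 / (b + U)`. -/
lemma one_div_add_relative_error_le {a b L U t y ε : ℝ} (ha : 0 < a) (hL : 0 < L) (hU : 0 < U)
    (hUL : U * (a + L) = 1) (hLU : L * (b + U) = 1) (hat : a ≤ t) (htb : t ≤ b)
    (hy : 0 < y) (hε : 0 ≤ ε) (hLy : L ≤ y * (1 + ε)) (hyU : y ≤ U * (1 + ε)) :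
    L ≤ 1 / (t + y) * (1 + L * U * ε) ∧ 1 / (t + y) ≤ U * (1 + L * U * ε) := by
  have hty : 0 < t + y := by linarith
  constructor
  · rw [one_div_mul_eq_div, le_div_iff₀ hty]
    calc L * (t + y) ≤ L * (b + U * (1 + ε)) := by gcongr
      _ = 1 + L * U * ε := by linear_combination hLU
  · rw [div_le_iff₀ hty]
    have hr : 0 ≤ L * U * (U * a) * ε ^ 2 := by positivity
    have key : 1 + ε ≤ U * (1 + L * U * ε) * (t + y) * (1 + ε) :=
      calc 1 + ε ≤ 1 + ε + L * U * (U * a) * ε ^ 2 := by linarith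
        _ = U * (1 + L * U * ε) * (a * (1 + ε) + L) := by
          linear_combination (-1 - ε - ε * L * U) * hUL
        _ ≤ U * (1 + L * U * ε) * (t * (1 + ε) + y * (1 + ε)) := by gcongr
        _ = _ := by ring
    exact le_of_mul_le_mul_right (by linarith) (by linarith : 0 < 1 + ε)

lemma cfrac_nonneg_s11 {l : List ℝ} (h : ∀ s ∈ l, 0 ≤ s) : 0 ≤ cfrac l := by
  induction l with
  | nil => simp [cfrac]
  | cons t l ih =>
    rw [List.forall_mem_cons] at h
    have := ih h.2
    have := h.1
    simp only [cfrac]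
    positivity

/-- A nonempty continued fraction with entries in `[a, b]` is exponentially close, in its length,
to the interval `[L, U]` with `U = 1 / (a + L)` and `L = 1 / (b + U)`. -/
lemma cfrac_cons_relative_error_le {a b L U : ℝ} (ha : 0 < a) (hL : 0 < L) (hU : 0 < U)
    (hUL : U * (a + L) = 1) (hLU : L * (b + U) = 1) (l : List ℝ) (t : ℝ)
    (h : ∀ s ∈ t :: l, a ≤ s ∧ s ≤ b) :
    L ≤ cfrac (t :: l) * (1 + L / a * (L * U) ^ l.length) ∧
      cfrac (t :: l) ≤ U * (1 + L / a * (L * U) ^ l.length) := by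
  induction l generalizing t with
  | nil =>
    obtain ⟨hat, htb⟩ := h t (by simp)
    have ht : 0 < t := ha.trans_le hat
    simp only [cfrac, add_zero, List.length_nil, pow_zero, mul_one]
    constructor
    · rw [one_div_mul_eq_div, le_div_iff₀ ht]
      have : 0 < L / a := by positivity
      nlinarith [mul_pos hL hU, mul_le_mul_of_nonneg_left htb hL.le]
    · calc 1 / t ≤ 1 / a := by gcongr
        _ = U * (1 + L / a) := by
          field_simp
          linear_combination -hUL
  | cons s l ih =>
    rw [List.forall_mem_cons] at h
    obtain ⟨⟨hat, htb⟩, hl⟩ := h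
    obtain ⟨h₁, h₂⟩ := ih s hl
    have hs : 0 < cfrac (s :: l) := by
      have h0 : 0 ≤ cfrac l :=
        cfrac_nonneg_s11 fun r hr => ha.le.trans (hl r (List.mem_cons_of_mem s hr)).1
      have : 0 < s := ha.trans_le (hl s (by simp)).1
      simp only [cfrac]
      positivity
    have := one_div_add_relative_error_le ha hL hU hUL hLU hat htb hs (by positivity) h₁ h₂
    rw [List.length_cons, show L / a * (L * U) ^ (l.length + 1)
      = L * U * (L / a * (L * U) ^ l.length) by ring]
    exact this

/-- `q / (√(p² + q) + p)` is the positive root of `y² + 2 p y = q`. -/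
lemma div_sqrt_add_quadratic {p q : ℝ} (hp : 0 < p) (hq : 0 < q) :
    (q / (√(p ^ 2 + q) + p)) ^ 2 + 2 * p * (q / (√(p ^ 2 + q) + p)) = q := by
  have hs := Real.sq_sqrt (show 0 ≤ p ^ 2 + q by positivity)
  have : 0 < √(p ^ 2 + q) + p := by positivity
  generalize √(p ^ 2 + q) = s at *
  field_simp
  linear_combination -hs

lemma eq_of_sq_add_mul_eq {p y z : ℝ} (hp : 0 < p) (hy : 0 < y) (hz : 0 < z)
    (h : y ^ 2 + p * y = z ^ 2 + p * z) : y = z := by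
  have h' : (y - z) * (y + z + p) = 0 := by linear_combination h
  rcases mul_eq_zero.mp h' with h' | h' <;> linarith

/-- Two-sided bounds for the continued fraction `G(x) = [xc₁, xc₂, …]` when
`0 < A ≤ c_k ≤ B` for all `k`. -/
theorem continued_fraction_bounds
    (c : ℕ → ℝ) (A B : ℝ) (hA : 0 < A)
    (hc : ∀ k : ℕ, 1 ≤ k → A ≤ c k ∧ c k ≤ B)
    (x : ℝ) (hx : 0 < x) (G : ℝ)
    (hG : Tendsto (fun k : ℕ =>
        cfrac ((List.range k).map fun i => x * c (i + 1))) atTop (nhds G)) :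
    (A / B) / (Real.sqrt ((x * A / 2) ^ 2 + A / B) + x * A / 2) ≤ G ∧
      G ≤ (B / A) / (Real.sqrt ((x * B / 2) ^ 2 + B / A) + x * B / 2) := by
  have hB : 0 < B := hA.trans_le ((hc 1 le_rfl).1.trans (hc 1 le_rfl).2)
  have hLq := div_sqrt_add_quadratic (p := x * A / 2) (q := A / B) (by positivity) (by positivity)
  have hUq := div_sqrt_add_quadratic (p := x * B / 2) (q := B / A) (by positivity) (by positivity)
  have hL : 0 < (A / B) / (√((x * A / 2) ^ 2 + A / B) + x * A / 2) := by positivity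
  have hU : 0 < (B / A) / (√((x * B / 2) ^ 2 + B / A) + x * B / 2) := by positivity
  generalize (A / B) / (√((x * A / 2) ^ 2 + A / B) + x * A / 2) = L at *
  generalize (B / A) / (√((x * B / 2) ^ 2 + B / A) + x * B / 2) = U at *
  have hBL : B * (L ^ 2 + x * A * L) = A := by
    field_simp at hLq
    linear_combination hLq
  have hUeq : U = B / A * L := by
    refine eq_of_sq_add_mul_eq (p := x * B) (by positivity) hU (by positivity) ?_
    calc U ^ 2 + x * B * U = B / A := by linear_combination hUq
      _ = _ := by
        field_simp
        linear_combination -hBL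
  have hUL : U * (x * A + L) = 1 := by
    rw [hUeq]
    field_simp
    linear_combination hBL
  have hLU : L * (x * B + U) = 1 := by
    rw [hUeq]
    field_simp
    linear_combination hBL
  have hr : L * U < 1 := by nlinarith [mul_pos hU (mul_pos hx hA)]
  have hε : Tendsto (fun k : ℕ => 1 + L / (x * A) * (L * U) ^ k) atTop (𝓝 1) := by
    simpa using ((tendsto_pow_atTop_nhds_zero_of_lt_one (by positivity) hr).const_mul
      (L / (x * A))).const_add 1
  have hG' := hG.comp (tendsto_add_atTop_nat 1)
  have hbound (k : ℕ) := cfrac_cons_relative_error_le (mul_pos hx hA) hL hU hUL hLU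
    ((List.range k).map fun i => x * c (i + 1 + 1)) (x * c 1) (by
      simp only [List.forall_mem_cons, List.forall_mem_map]
      exact ⟨⟨by gcongr; exact (hc 1 le_rfl).1, by gcongr; exact (hc 1 le_rfl).2⟩,
        fun i _ => ⟨by gcongr; exact (hc _ (by omega)).1, by gcongr; exact (hc _ (by omega)).2⟩⟩)
  have hlist (k : ℕ) : ((List.range (k + 1)).map fun i => x * c (i + 1)) =
      x * c 1 :: (List.range k).map fun i => x * c (i + 1 + 1) := by
    simp [List.range_succ_eq_map, Function.comp_def]
  simp only [← hlist, List.length_map, List.length_range] at hbound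
  constructor
  · simpa using ge_of_tendsto' (hG'.mul hε) fun k => (hbound k).1
  · simpa using le_of_tendsto_of_tendsto' hG' (hε.const_mul U) fun k => (hbound k).2
end

section
/- Let p ∈ ℤ² with ‖p‖ > 2√2, and write p⊥ = (−p₂, p₁) for p = (p₁,p₂). Then there exists q ∈ ℤ² with ‖q − (3/4)·p⊥‖ < (1/4)·‖p‖; moreover, every q ∈ ℝ² satisfying ‖q − (3/4)·p⊥‖ < (1/4)·‖p‖ satisfies ‖q‖ < ‖p‖, ‖q + p‖ > ‖p‖, and ‖q − p‖ > ‖p‖. (Such a q gives rise to a subsystem of type I, so Theorem 2.1 applies.) -/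
open Filter Topology

/-- Euclidean norm on `ℝ²` (as a pair of reals). -/
noncomputable def rnorm (v : ℝ × ℝ) : ℝ := Real.sqrt (v.1 ^ 2 + v.2 ^ 2)

/-- If `‖p‖ > 2√2`, there is a lattice point `q` within distance `‖p‖/4` of
`(3/4)p⊥`; moreover, every point `q ∈ ℝ²` within distance `‖p‖/4` of `(3/4)p⊥`
satisfies `‖q‖ < ‖p‖`, `‖q + p‖ > ‖p‖` and `‖q − p‖ > ‖p‖`. -/
theorem exists_typeI_point (p : ℤ × ℤ) (hp : 2 * Real.sqrt 2 < znorm p) :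
    (∃ q : ℤ × ℤ,
        rnorm ((q.1 : ℝ) - (3 / 4) * (-(p.2 : ℝ)), (q.2 : ℝ) - (3 / 4) * (p.1 : ℝ))
          < (1 / 4) * znorm p) ∧
      ∀ q : ℝ × ℝ,
        rnorm (q.1 - (3 / 4) * (-(p.2 : ℝ)), q.2 - (3 / 4) * (p.1 : ℝ))
            < (1 / 4) * znorm p →
          rnorm q < znorm p ∧
          znorm p < rnorm (q.1 + (p.1 : ℝ), q.2 + (p.2 : ℝ)) ∧
          znorm p < rnorm (q.1 - (p.1 : ℝ), q.2 - (p.2 : ℝ)) := by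
  have hN : (8 : ℝ) < (p.1 : ℝ) ^ 2 + (p.2 : ℝ) ^ 2 := by
    have h : (2 * Real.sqrt 2) ^ 2 < znorm p ^ 2 := by gcongr
    rw [mul_pow, Real.sq_sqrt (by norm_num), znorm, Real.sq_sqrt (by positivity)] at h
    linarith
  have hquarter : (1 / 4) * znorm p = Real.sqrt (((p.1 : ℝ) ^ 2 + (p.2 : ℝ) ^ 2) / 16) := by
    rw [Real.sqrt_div (by positivity), show (16 : ℝ) = 4 ^ 2 by norm_num,
      Real.sqrt_sq (by norm_num), znorm]
    ring
  simp only [hquarter]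
  simp only [rnorm, znorm]
  constructor
  · refine ⟨(round ((3 / 4) * (-(p.2 : ℝ))), round ((3 / 4) * (p.1 : ℝ))), ?_⟩
    refine Real.sqrt_lt_sqrt (by positivity) ?_
    have h₁ := abs_le.mp (abs_sub_round ((3 / 4) * (-(p.2 : ℝ))))
    have h₂ := abs_le.mp (abs_sub_round ((3 / 4) * (p.1 : ℝ)))
    nlinarith
  · rintro ⟨a, b⟩ hq
    generalize (p.1 : ℝ) = x at *
    generalize (p.2 : ℝ) = y at *
    dsimp only at hq ⊢
    rw [Real.sqrt_lt_sqrt_iff (by positivity)] at hq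
    obtain ⟨u, rfl⟩ : ∃ u, a = (3 / 4) * -y + u := ⟨a - (3 / 4) * -y, by ring⟩
    obtain ⟨v, rfl⟩ : ∃ v, b = (3 / 4) * x + v := ⟨b - (3 / 4) * x, by ring⟩
    simp only [add_sub_cancel_left] at hq
    refine ⟨Real.sqrt_lt_sqrt (by positivity) ?_, Real.sqrt_lt_sqrt (by positivity) ?_,
      Real.sqrt_lt_sqrt (by positivity) ?_⟩
    · linarith [sq_nonneg (2 * u + y / 2), sq_nonneg (2 * v - x / 2)]
    · linarith [sq_nonneg (5 * u + (-(3 / 4) * y + x)), sq_nonneg (5 * v + ((3 / 4) * x + y))]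
    · linarith [sq_nonneg (5 * u + (-(3 / 4) * y - x)), sq_nonneg (5 * v + ((3 / 4) * x - y))]
end
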